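/- arXiv:1304.5109 — 3 statements merged into one kernel-verified Lean document; each statement's English description precedes it below -/
import Mathlib

section
/- For D = 3 and every N ≥ 9, the global density column satisfies L(3,N) ≤ 2·log₄((9N − 5)/4); in particular L(3,N) = O(log N). -/
open scoped Classical

/-- A configuration of KSPM: a sequence of height differences. -/
abbrev Config := ℕ → ℕ

/-- The result of firing column `i` in configuration `σ` (KSPM(D) rule). -/
def fireAt (D : ℕ) (σ : Config) (i : ℕ) : Config := fun j =>
  if j = i then σ i - D
  else if j + 1 = i then σ j + (D - 1)
  else if j = i + D - 1 then σ j + 1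
  else σ j

/-- `σ →_i σ'` : column `i` can be fired in `σ`, producing `σ'`. -/
def Step (D : ℕ) (σ : Config) (i : ℕ) (σ' : Config) : Prop :=
  D ≤ σ i ∧ σ' = fireAt D σ i

/-- `σ → σ'`. -/
def StepRel (D : ℕ) (σ σ' : Config) : Prop := ∃ i, Step D σ i σ'

/-- `σ →* σ'`. -/
def Reaches (D : ℕ) : Config → Config → Prop := Relation.ReflTransGen (StepRel D)

/-- A configuration is stable (a fixed point) when no transition applies. -/
def Stable (D : ℕ) (σ : Config) : Prop := ∀ i, σ i < D

/-- `Exec D σ s σ'` : the strategy `s` leads from `σ` to `σ'`. -/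
def Exec (D : ℕ) : Config → List ℕ → Config → Prop
  | σ, [], σ' => σ' = σ
  | σ, i :: s, σ' => D ≤ σ i ∧ Exec D (fireAt D σ i) s σ'

/-- The initial configuration with `N` stacked grains on column 0. -/
def grains (N : ℕ) : Config := fun i => if i = 0 then N else 0

/-- `σ^{↓0}` : one grain added on column 0. -/
def addGrain (σ : Config) : Config := fun i => if i = 0 then σ i + 1 else σ i

/-- `π(σ)` : the (unique) stable configuration reachable from `σ`. -/
noncomputable def piCfg (D : ℕ) (σ : Config) : Config :=
  Classical.epsilon fun μ => Reaches D σ μ ∧ Stable D μ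

/-- `π(N)` : the stable configuration reached from `N` stacked grains. -/
noncomputable def piN (D N : ℕ) : Config := piCfg D (grains N)

/-- The `k`-th avalanche: the lexicographically least strategy from
`π(k−1)^{↓0}` to `π(k)`. -/
noncomputable def avalanche (D k : ℕ) : List ℕ :=
  Classical.epsilon fun s =>
    Exec D (addGrain (piN D (k - 1))) s (piN D k) ∧
    ∀ s', Exec D (addGrain (piN D (k - 1))) s' (piN D k) →
      s = s' ∨ List.Lex (· < ·) s s'

/-- `p` is a peak of the strategy `s` : it is fired at some time, and is
larger than every previously fired column. -/
def IsPeak (s : List ℕ) (p : ℕ) : Prop :=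
  ∃ t : Fin s.length, s.get t = p ∧ ∀ t' : Fin s.length, t' < t → s.get t' < p

/-- An avalanche is dense from `l` : with `m` its greatest fired column, every
column of `[l, m]` is fired. -/
def DenseFrom (s : List ℕ) (l : ℕ) : Prop :=
  ∃ m, (∀ i, l ≤ i → i ≤ m → i ∈ s) ∧ ∀ i, m < i → i ∉ s

/-- `L'(D,k)` : the least column from which the `k`-th avalanche is dense. -/
noncomputable def Lp (D k : ℕ) : ℕ := sInf {l | DenseFrom (avalanche D k) l}

/-- The global density column `L(D,N)`. -/
noncomputable def Lgdc (D N : ℕ) : ℕ := (Finset.Icc 1 N).sup (Lp D)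

/-- Indices `k ∈ [1,N]` of the long avalanches up to `N` (those firing column
`L(D,N)+D−1`), in increasing order: this enumerates `Φ(D,N)`. -/
noncomputable def longList (D N : ℕ) : List ℕ :=
  (List.range (N + 1)).filter fun k =>
    decide (1 ≤ k ∧ Lgdc D N + D - 1 ∈ avalanche D k)

/-! ### Basic facts on executions -/

theorem kspm_exec_append (σ : Config) (s t : List ℕ) (σ' : Config) :
    Exec 3 σ (s ++ t) σ' ↔ ∃ τ, Exec 3 σ s τ ∧ Exec 3 τ t σ' := by
  induction s generalizing σ with
  | nil => simp [Exec]
  | cons a s ih =>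
    simp only [List.cons_append, Exec, ih]
    constructor
    · rintro ⟨h, τ, h1, h2⟩; exact ⟨τ, ⟨h, h1⟩, h2⟩
    · rintro ⟨τ, ⟨h, h1⟩, h2⟩; exact ⟨h, τ, h1, h2⟩

theorem kspm_exec_snoc (σ : Config) (s : List ℕ) (i : ℕ) (σ' : Config) :
    Exec 3 σ (s ++ [i]) σ' ↔ ∃ τ, Exec 3 σ s τ ∧ 3 ≤ τ i ∧ σ' = fireAt 3 τ i := by
  rw [kspm_exec_append]; simp [Exec]

theorem kspm_reaches_iff (σ σ' : Config) : Reaches 3 σ σ' ↔ ∃ s, Exec 3 σ s σ' := by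
  constructor
  · intro h
    induction h with
    | refl => exact ⟨[], rfl⟩
    | tail _ h ih =>
      obtain ⟨s, hs⟩ := ih
      obtain ⟨i, h1, h2⟩ := h
      exact ⟨s ++ [i], (kspm_exec_snoc _ _ _ _).2 ⟨_, hs, h1, h2⟩⟩
  · rintro ⟨s, hs⟩
    induction s generalizing σ with
    | nil => simp only [Exec] at hs; subst hs; exact Relation.ReflTransGen.refl
    | cons a s ih =>
      simp only [Exec] at hs
      exact Relation.ReflTransGen.head ⟨a, hs.1, rfl⟩ (ih _ hs.2)

/-- contribution of the column two places to the left -/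
def kspmLeft (s : List ℕ) (i : ℕ) : ℕ := if 2 ≤ i then s.count (i - 2) else 0

theorem kspm_fire_val (σ : Config) (a i : ℕ) (h : 3 ≤ σ a) :
    (fireAt 3 σ a i : ℤ) = σ i + (if i = a + 2 then 1 else 0) - 3 * (if i = a then 1 else 0)
      + 2 * (if i + 1 = a then 1 else 0) := by
  unfold fireAt
  by_cases h1 : i = a
  · subst h1; simp; omega
  · by_cases h2 : i + 1 = a
    · have : i ≠ a + 2 := by omega
      simp [h1, h2, this]
    · by_cases h3 : i = a + 2
      · have : ¬ (a + 2 + 1 = a) := by omega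
        simp [h3, this]
      · have : i ≠ a + 3 - 1 := by omega
        simp [h1, h2, h3]

theorem kspm_exec_val (σ : Config) (s : List ℕ) (σ' : Config) (h : Exec 3 σ s σ') (i : ℕ) :
    (σ' i : ℤ) = σ i + kspmLeft s i - 3 * s.count i + 2 * s.count (i + 1) := by
  induction s generalizing σ with
  | nil => simp only [Exec] at h; subst h; simp [kspmLeft]
  | cons a s ih =>
    simp only [Exec] at h
    rw [ih _ h.2, kspm_fire_val σ a i h.1]
    unfold kspmLeft
    simp only [List.count_cons, beq_iff_eq]
    by_cases h2 : 2 ≤ i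
    · have e1 : (i = a + 2) ↔ (a = i - 2) := by omega
      have e2 : (i = a) ↔ (a = i) := by omega
      have e3 : (i + 1 = a) ↔ (a = i + 1) := by omega
      simp only [e1, e2, e3, h2, if_true]
      push_cast
      ring
    · have e1 : ¬ (i = a + 2) := by omega
      have e2 : (i = a) ↔ (a = i) := by omega
      have e3 : (i + 1 = a) ↔ (a = i + 1) := by omega
      simp only [e1, e2, e3, h2, if_false]
      push_cast
      ring

/-! ### Structure of an avalanche -/

/-- The peak property. -/
def KPeak (σ : Config) (s : List ℕ) : Prop :=
  ∀ j, (∃ i, j < i ∧ i ∈ s) →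
    ∃ p, (p = j + 1 ∨ p = j + 2) ∧ p ∈ s ∧ 2 ≤ p ∧ p - 2 ∈ s ∧ σ p = 2

theorem kspm_aval (σ : Config) (hσ : Stable 3 σ) (s : List ℕ) (σ' : Config)
    (h : Exec 3 (addGrain σ) s σ') : s.Nodup ∧ KPeak σ s := by
  induction s using List.reverseRecOn generalizing σ' with
  | nil =>
    refine ⟨List.nodup_nil, ?_⟩
    rintro j ⟨i, _, hi⟩; simp at hi
  | append_singleton s i ih =>
    obtain ⟨τ, h1, h2, -⟩ := (kspm_exec_snoc _ _ _ _).1 h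
    obtain ⟨hn, hp⟩ := ih _ h1
    have hv := kspm_exec_val _ _ _ h1 i
    have c1 : s.count (i + 1) ≤ 1 := List.nodup_iff_count_le_one.1 hn _
    have c2 : kspmLeft s i ≤ 1 := by
      unfold kspmLeft; split_ifs
      · exact List.nodup_iff_count_le_one.1 hn _
      · omega
    have c3 : i < 2 → kspmLeft s i = 0 := by
      intro h; unfold kspmLeft; rw [if_neg (by omega)]
    have hs := hσ i
    have ha : addGrain σ i = if i = 0 then σ i + 1 else σ i := rfl
    have hni : i ∉ s := by
      intro hi
      have : 1 ≤ s.count i := List.count_pos_iff.2 hi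
      by_cases h0 : i = 0
      · have := c3 (by omega)
        rw [if_pos h0] at ha
        omega
      · rw [if_neg h0] at ha
        omega
    have c4 : s.count i = 0 := List.count_eq_zero.2 hni
    refine ⟨?_, ?_⟩
    · rw [List.nodup_append]
      refine ⟨hn, by simp, ?_⟩
      intro a has b hb hab
      simp at hb; subst hb; subst hab; exact hni has
    · rintro j ⟨k, hk, hks⟩
      by_cases hex : ∃ k, j < k ∧ k ∈ s
      · obtain ⟨p, q1, q2, q3, q4, q5⟩ := hp j hex
        exact ⟨p, q1, List.mem_append_left _ q2, q3, List.mem_append_left _ q4, q5⟩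
      · push Not at hex
        have hki : k = i := by
          rcases List.mem_append.1 hks with h | h
          · exact absurd h (hex k hk)
          · simpa using h
        subst hki
        have c5 : s.count (k + 1) = 0 := List.count_eq_zero.2 (hex _ (by omega))
        rw [if_neg (by omega)] at ha
        have hk2 : 2 ≤ k := by
          by_contra hlt
          have := c3 (by omega)
          omega
        have hl : kspmLeft s k = s.count (k - 2) := by unfold kspmLeft; rw [if_pos hk2]
        have hm : k - 2 ∈ s := List.count_pos_iff.1 (by omega)
        have hle : k - 2 ≤ j := by
          by_contra hlt
          exact hex _ (by omega) hm
        exact ⟨k, by omega, by simp, hk2, List.mem_append_left _ hm, by omega⟩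

/-- finite support -/
def KSupp (σ : Config) (M : ℕ) : Prop := ∀ i, M ≤ i → σ i = 0

theorem kspm_aval_lt (σ : Config) (hσ : Stable 3 σ) (M : ℕ) (hM : KSupp σ M) (s : List ℕ)
    (σ' : Config) (h : Exec 3 (addGrain σ) s σ') : ∀ i ∈ s, i < M + 1 := by
  intro i hi
  by_contra hlt
  obtain ⟨p, q1, q2, q3, q4, q5⟩ := (kspm_aval σ hσ s σ' h).2 M ⟨i, by omega, hi⟩
  have := hM p (by omega)
  omega

theorem kspm_aval_len (σ : Config) (hσ : Stable 3 σ) (M : ℕ) (hM : KSupp σ M) (s : List ℕ)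
    (σ' : Config) (h : Exec 3 (addGrain σ) s σ') : s.length ≤ M + 1 := by
  have h1 := kspm_aval_lt σ hσ M hM s σ' h
  have h2 := (kspm_aval σ hσ s σ' h).1
  have : s.toFinset ⊆ Finset.range (M + 1) := by
    intro i hi; simp at hi; simpa using h1 i hi
  have := Finset.card_le_card this
  rwa [List.toFinset_card_of_nodup h2, Finset.card_range] at this

theorem kspm_aval_stab (σ : Config) (hσ : Stable 3 σ) (M : ℕ) (hM : KSupp σ M) :
    ∃ s σ', Exec 3 (addGrain σ) s σ' ∧ Stable 3 σ' := by
  by_contra hcon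
  push Not at hcon
  have : ∀ n : ℕ, ∃ s σ', Exec 3 (addGrain σ) s σ' ∧ s.length = n := by
    intro n
    induction n with
    | zero => exact ⟨[], _, rfl, rfl⟩
    | succ n ih =>
      obtain ⟨s, σ', h1, h2⟩ := ih
      have h3 := hcon s σ' h1
      unfold Stable at h3
      push Not at h3
      obtain ⟨i, hi⟩ := h3
      exact ⟨s ++ [i], _, (kspm_exec_snoc _ _ _ _).2 ⟨σ', h1, hi, rfl⟩, by simp [h2]⟩
  obtain ⟨s, σ', h1, h2⟩ := this (M + 2)
  have := kspm_aval_len σ hσ M hM s σ' h1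
  omega

theorem kspm_supp_exec (σ : Config) (s : List ℕ) (σ' : Config) (h : Exec 3 σ s σ')
    (hs : ∃ M, KSupp σ M) : ∃ M, KSupp σ' M := by
  induction s generalizing σ with
  | nil => simp only [Exec] at h; subst h; exact hs
  | cons a s ih =>
    simp only [Exec] at h
    apply ih _ h.2
    obtain ⟨M, hM⟩ := hs
    refine ⟨M + a + 3, fun i hi => ?_⟩
    have := kspm_fire_val σ a i h.1
    rw [if_neg (by omega), if_neg (by omega), if_neg (by omega), hM i (by omega)] at this
    simpa using this

theorem kspm_addGrain_exec (σ : Config) (s : List ℕ) (σ' : Config) (h : Exec 3 σ s σ') :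
    Exec 3 (addGrain σ) s (addGrain σ') := by
  induction s generalizing σ with
  | nil => simp only [Exec] at h ⊢; rw [h]
  | cons a s ih =>
    simp only [Exec] at h ⊢
    have e : fireAt 3 (addGrain σ) a = addGrain (fireAt 3 σ a) := by
      funext i
      have h0 := h.1
      unfold fireAt addGrain
      by_cases ha : a = 0
      · subst ha
        by_cases hi : i = 0
        · subst hi; simp; omega
        · simp [hi]
      · by_cases hi : i = 0
        · subst hi
          by_cases ha1 : 1 = a
          · simp [← ha1]
          · have : ¬ (0 = a) := by omega
            simp [ha1, this]
        · simp [ha, hi]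
    refine ⟨?_, ?_⟩
    · have := h.1
      unfold addGrain; split_ifs <;> omega
    · rw [e]; exact ih _ h.2

theorem kspm_addGrain_grains (N : ℕ) : addGrain (grains N) = grains (N + 1) := by
  funext i; unfold addGrain grains; split_ifs <;> rfl

theorem kspm_exists_stab (N : ℕ) : ∃ s σ', Exec 3 (grains N) s σ' ∧ Stable 3 σ' := by
  induction N with
  | zero =>
    refine ⟨[], _, rfl, fun i => ?_⟩
    unfold grains; split_ifs <;> omega
  | succ N ih =>
    obtain ⟨s, σ', h1, h2⟩ := ih
    obtain ⟨M, hM⟩ := kspm_supp_exec _ _ _ h1 ⟨1, fun i hi => by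
      unfold grains; rw [if_neg (by omega)]⟩
    obtain ⟨t, μ, h3, h4⟩ := kspm_aval_stab σ' h2 M hM
    refine ⟨s ++ t, μ, (kspm_exec_append _ _ _ _).2 ⟨addGrain σ', ?_, h3⟩, h4⟩
    rw [← kspm_addGrain_grains]
    exact kspm_addGrain_exec _ _ _ h1

theorem kspm_piN_spec (N : ℕ) : Reaches 3 (grains N) (piN 3 N) ∧ Stable 3 (piN 3 N) := by
  unfold piN piCfg
  apply Classical.epsilon_spec (p := fun μ => Reaches 3 (grains N) μ ∧ Stable 3 μ)
  obtain ⟨s, σ', h1, h2⟩ := kspm_exists_stab N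
  exact ⟨σ', (kspm_reaches_iff _ _).2 ⟨s, h1⟩, h2⟩

theorem kspm_supp_piN (N : ℕ) : ∃ M, KSupp (piN 3 N) M := by
  obtain ⟨s, hs⟩ := (kspm_reaches_iff _ _).1 (kspm_piN_spec N).1
  exact kspm_supp_exec _ _ _ hs ⟨1, fun i hi => by unfold grains; rw [if_neg (by omega)]⟩

/-! ### Confluence -/

theorem kspm_fire_comm (σ : Config) (a b : ℕ) (hab : a ≠ b) (ha : 3 ≤ σ a) (hb : 3 ≤ σ b) :
    3 ≤ fireAt 3 σ a b ∧ fireAt 3 (fireAt 3 σ a) b = fireAt 3 (fireAt 3 σ b) a := by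
  have key : ∀ a b, a ≠ b → 3 ≤ σ a → 3 ≤ σ b → 3 ≤ fireAt 3 σ a b := by
    intro a b hab ha hb
    have := kspm_fire_val σ a b ha
    rw [if_neg (c := b = a) (by omega)] at this
    split_ifs at this <;> omega
  have h1 := key a b hab ha hb
  have h2 := key b a hab.symm hb ha
  refine ⟨h1, ?_⟩
  funext i
  have e1 := kspm_fire_val _ b i h1
  have e2 := kspm_fire_val _ a i h2
  rw [kspm_fire_val σ a i ha] at e1
  rw [kspm_fire_val σ b i hb] at e2
  have : (fireAt 3 (fireAt 3 σ a) b i : ℤ) = fireAt 3 (fireAt 3 σ b) a i := by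
    rw [e1, e2]; ring
  exact_mod_cast this

theorem kspm_stable_reaches (σ σ' : Config) (hσ : Stable 3 σ) (h : Reaches 3 σ σ') : σ' = σ := by
  rcases Relation.ReflTransGen.cases_head h with h | ⟨c, ⟨i, h1, _⟩, _⟩
  · exact h.symm
  · have := hσ i; omega

theorem kspm_unique (σ μ ν : Config) (h1 : Reaches 3 σ μ) (h2 : Reaches 3 σ ν)
    (s1 : Stable 3 μ) (s2 : Stable 3 ν) : μ = ν := by
  have := Relation.church_rosser (r := StepRel 3) (a := σ) (b := μ) (c := ν) ?_ h1 h2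
  · obtain ⟨d, hd1, hd2⟩ := this
    rw [← kspm_stable_reaches _ _ s1 hd1, ← kspm_stable_reaches _ _ s2 hd2]
  · rintro a b c ⟨i, hi, rfl⟩ ⟨j, hj, rfl⟩
    by_cases hij : i = j
    · subst hij
      exact ⟨_, Relation.ReflGen.refl, Relation.ReflTransGen.refl⟩
    · obtain ⟨k1, k2⟩ := kspm_fire_comm a i j hij hi hj
      obtain ⟨k3, _⟩ := kspm_fire_comm a j i (Ne.symm hij) hj hi
      refine ⟨fireAt 3 (fireAt 3 a i) j, Relation.ReflGen.single ⟨j, k1, rfl⟩,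
        Relation.ReflTransGen.single ⟨i, k3, k2⟩⟩

/-! ### The avalanche is well defined -/

theorem kspm_exists_aval (n : ℕ) : ∃ s, Exec 3 (addGrain (piN 3 n)) s (piN 3 (n + 1)) := by
  obtain ⟨hr, hs⟩ := kspm_piN_spec n
  obtain ⟨M, hM⟩ := kspm_supp_piN n
  obtain ⟨s, σ', h1, h2⟩ := kspm_aval_stab _ hs M hM
  obtain ⟨t, ht⟩ := (kspm_reaches_iff _ _).1 hr
  have ht' := kspm_addGrain_exec _ _ _ ht
  rw [kspm_addGrain_grains] at ht'
  have h3 : Reaches 3 (grains (n + 1)) σ' :=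
    (kspm_reaches_iff _ _).2 ⟨t ++ s, (kspm_exec_append _ _ _ _).2 ⟨_, ht', h1⟩⟩
  obtain ⟨hr', hs'⟩ := kspm_piN_spec (n + 1)
  rw [kspm_unique _ _ _ hr' h3 hs' h2]
  exact ⟨s, h1⟩

theorem kspm_avalanche_exec (n : ℕ) :
    Exec 3 (addGrain (piN 3 n)) (avalanche 3 (n + 1)) (piN 3 (n + 1)) := by
  have key : ∃ s, Exec 3 (addGrain (piN 3 (n + 1 - 1))) s (piN 3 (n + 1)) ∧
    ∀ s', Exec 3 (addGrain (piN 3 (n + 1 - 1))) s' (piN 3 (n + 1)) →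
      s = s' ∨ List.Lex (· < ·) s s' := by
    rw [Nat.add_sub_cancel]
    obtain ⟨M, hM⟩ := kspm_supp_piN n
    have hs := (kspm_piN_spec n).2
    set S : Set (List ℕ) := {s | Exec 3 (addGrain (piN 3 n)) s (piN 3 (n + 1))} with hS
    have hfin : S.Finite := by
      have hf : {l : List (Fin (M + 1)) | l.length ≤ M + 1}.Finite :=
        List.finite_length_le _ _
      refine (hf.image (List.map Fin.val)).subset ?_
      intro s hsS
      have h1 := kspm_aval_lt _ hs M hM s _ hsS
      have h2 := kspm_aval_len _ hs M hM s _ hsS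
      refine ⟨s.pmap (fun a ha => ⟨a, ha⟩) h1, by simpa using h2, ?_⟩
      rw [List.map_pmap]
      simp
    obtain ⟨s, hsS, hmin⟩ := Set.exists_min_image S id hfin (kspm_exists_aval n)
    refine ⟨s, hsS, fun s' hs' => ?_⟩
    rcases (hmin s' hs').eq_or_lt with h | h
    · exact Or.inl h
    · exact Or.inr h
  have := Classical.epsilon_spec key
  exact this.1

/-! ### Density -/

theorem kspm_dense (σ : Config) (hσ : Stable 3 σ) (s : List ℕ) (σ' : Config)
    (h : Exec 3 (addGrain σ) s σ') (hσ' : Stable 3 σ') (h0 : σ 0 = 2) (j : ℕ)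
    (hpat : ∀ i < j, σ (2 * i) = 2 ∧ σ (2 * i + 1) = 0)
    (hbr : ¬ (σ (2 * j) = 2 ∧ σ (2 * j + 1) = 0)) : DenseFrom s (2 * j) := by
  obtain ⟨hn, hp⟩ := kspm_aval σ hσ s σ' h
  have hc : ∀ i, s.count i ≤ 1 := fun i => List.nodup_iff_count_le_one.1 hn i
  have hpos : ∀ i, i ∈ s → s.count i = 1 := fun i hi =>
    le_antisymm (hc i) (List.count_pos_iff.2 hi)
  have hzero : ∀ i, i ∉ s → s.count i = 0 := fun i hi => List.count_eq_zero.2 hi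
  -- 0 is fired
  have hmem0 : 0 ∈ s := by
    by_contra hni
    have hv := kspm_exec_val _ _ _ h 0
    have := hσ' 0
    have ha : addGrain σ 0 = σ 0 + 1 := rfl
    have := hzero 0 hni
    omega
  have hval : ∀ i, 1 ≤ i →
      (σ' i : ℤ) = σ i + kspmLeft s i - 3 * s.count i + 2 * s.count (i + 1) := by
    intro i hi
    rw [kspm_exec_val _ _ _ h i]
    unfold addGrain; rw [if_neg (by omega)]
  have hodd : ∀ i < j, 2 * i + 1 ∉ s := by
    intro i
    induction i with
    | zero =>
      intro hi hm
      have hv := hval 1 (by omega)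
      have h1 := (hpat 0 hi).2
      have h2 : kspmLeft s 1 = 0 := by unfold kspmLeft; rw [if_neg (by omega)]
      have h3 := hpos _ hm
      have h4 := hc 2
      simp only [Nat.mul_zero, Nat.zero_add] at h1 h3
      norm_num at hv
      omega
    | succ i ih =>
      intro hi hm
      have hv := hval (2 * (i + 1) + 1) (by omega)
      have h1 := (hpat (i + 1) hi).2
      have h2 : kspmLeft s (2 * (i + 1) + 1) = 0 := by
        unfold kspmLeft; rw [if_pos (by omega)]
        exact hzero _ (by
          have := ih (by omega)
          rwa [show 2 * (i + 1) + 1 - 2 = 2 * i + 1 by omega])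
      have h3 := hpos _ hm
      have h4 := hc (2 * (i + 1) + 1 + 1)
      omega
  -- maximal element
  have hne : s.toFinset.Nonempty := ⟨0, by simpa using hmem0⟩
  obtain ⟨m, hms, hmax⟩ := Finset.exists_max_image s.toFinset id hne
  simp only [List.mem_toFinset, id] at hms hmax
  refine ⟨m, ?_, fun i hi hi' => by have := hmax i hi'; omega⟩
  intro i hi him
  have hleft : ∀ p, p ≤ 2 * j + 1 → 2 ≤ p → p - 2 ∈ s → p ≠ 2 * j + 1 := by
    rintro p - h2 h3 rfl
    exact hodd (j - 1) (by omega) (by rwa [show 2 * (j - 1) + 1 = 2 * j + 1 - 2 by omega])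
  have h2j : 2 * j ∈ s ∧ σ (2 * j) = 2 := by
    by_cases hj : j = 0
    · subst hj; exact ⟨hmem0, h0⟩
    · obtain ⟨p, q1, q2, q3, q4, q5⟩ := hp (2 * j - 1) ⟨m, by omega, hms⟩
      have := hleft p (by omega) q3 q4
      have hpj : p = 2 * j := by omega
      subst hpj
      exact ⟨q2, q5⟩
  have hnz : 1 ≤ σ (2 * j + 1) := by
    by_contra hlt
    exact hbr ⟨h2j.2, by omega⟩
  -- column i is fired as soon as it has enough support
  have hfire : ∀ i, 1 ≤ i → 3 ≤ σ i + kspmLeft s i + 2 * s.count (i + 1) → i ∈ s := by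
    intro i hi h3
    by_contra hni
    have := hval i hi
    have := hzero i hni
    have := hσ' i
    omega
  have step1 : 2 * j < m → 2 * j + 1 ∈ s := by
    intro hlt
    obtain ⟨p, q1, q2, q3, q4, q5⟩ := hp (2 * j) ⟨m, hlt, hms⟩
    rcases q1 with q1 | q1
    · rwa [← q1]
    · apply hfire _ (by omega)
      have := hpos p q2
      rw [q1] at this
      rw [show 2 * j + 1 + 1 = 2 * j + 2 by omega]
      omega
  have hall : ∀ d, 2 * j + d ≤ m → 2 * j + d ∈ s := by
    intro d
    induction d using Nat.strong_induction_on with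
    | _ d ih =>
      intro hd
      rcases d with _ | _ | d
      · exact h2j.1
      · exact step1 (by omega)
      · obtain ⟨p, q1, q2, q3, q4, q5⟩ := hp (2 * j + d + 1) ⟨m, by omega, hms⟩
        rcases q1 with q1 | q1
        · rw [show 2 * j + (d + 1 + 1) = p by omega]; exact q2
        · apply hfire _ (by omega)
          have h5 := hpos p q2
          have h6 : kspmLeft s (2 * j + (d + 1 + 1)) = 1 := by
            unfold kspmLeft; rw [if_pos (by omega)]
            rw [show 2 * j + (d + 1 + 1) - 2 = 2 * j + d by omega]
            exact hpos _ (ih d (by omega) (by omega))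
          rw [show 2 * j + (d + 1 + 1) + 1 = p by omega]
          omega
  have := hall (i - 2 * j) (by omega)
  rwa [show 2 * j + (i - 2 * j) = i by omega] at this

/-! ### The arithmetic bound -/

/-- Firing counts extended by the two virtual columns on the left. -/
def kspmA (N : ℕ) (s : List ℕ) : ℕ → ℤ
  | 0 => N
  | 1 => 0
  | (i + 2) => s.count i

theorem kspm_A_rec (N : ℕ) (s : List ℕ) (σ : Config) (h : Exec 3 (grains N) s σ) (i : ℕ) :
    (σ i : ℤ) = kspmA N s i - 3 * kspmA N s (i + 2) + 2 * kspmA N s (i + 3) := by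
  rw [kspm_exec_val _ _ _ h i]
  rcases i with _ | _ | i
  · simp [kspmA, kspmLeft, grains]
  · simp [kspmA, kspmLeft, grains]
  · simp [kspmA, kspmLeft, grains]

theorem kspm_count_bound (N : ℕ) (s : List ℕ) (σ : Config) (h : Exec 3 (grains N) s σ) :
    2 * s.count 0 ≤ N := by
  have hsum : ∀ M, (∑ i ∈ Finset.range M, (σ i : ℤ)) =
      kspmA N s 0 + kspmA N s 1 - 2 * kspmA N s 2
        - kspmA N s M - kspmA N s (M + 1) + 2 * kspmA N s (M + 2) := by
    intro M
    induction M with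
    | zero => simp; ring
    | succ M ih =>
      rw [Finset.sum_range_succ, ih, kspm_A_rec N s σ h M]
      ring
  obtain ⟨B, hB⟩ : ∃ B, ∀ i ∈ s, i < B :=
    ⟨s.sum + 1, fun i hi => Nat.lt_succ_of_le (List.le_sum_of_mem hi)⟩
  have hz : ∀ i, B ≤ i → kspmA N s (i + 2) = 0 := by
    intro i hi
    simp only [kspmA]
    rw [List.count_eq_zero.2 (fun hm => by have := hB i hm; omega)]
    rfl
  have h1 := hsum (B + 2)
  rw [hz B le_rfl, show B + 2 + 1 = (B + 1) + 2 by ring, hz (B + 1) (by omega),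
    hz (B + 2) (by omega)] at h1
  have h2 : (0 : ℤ) ≤ ∑ i ∈ Finset.range (B + 2), (σ i : ℤ) :=
    Finset.sum_nonneg (fun _ _ => by positivity)
  simp only [kspmA] at h1
  omega

theorem kspm_pow_bound (N : ℕ) (s : List ℕ) (σ : Config) (h : Exec 3 (grains N) s σ) (j : ℕ)
    (hpat : ∀ i < j, σ (2 * i) = 2 ∧ σ (2 * i + 1) = 0) : 4 * 4 ^ j ≤ 9 * N + 4 := by
  set e : ℕ → ℤ := fun i => kspmA N s (i + 2) - 2 * kspmA N s (i + 1) + kspmA N s i with he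
  have hrec : ∀ i, (σ i : ℤ) = 2 * e (i + 1) + e i := by
    intro i
    rw [kspm_A_rec N s σ h i]
    simp only [he]
    ring
  have hpow : ∀ i ≤ j, 3 * e 0 + 2 = 4 ^ i * (3 * e (2 * i) + 2) := by
    intro i
    induction i with
    | zero => intro _; simp
    | succ i ih =>
      intro hi
      rw [ih (by omega)]
      have h1 := hrec (2 * i)
      have h2 := hrec (2 * i + 1)
      obtain ⟨h3, h4⟩ := hpat i (by omega)
      rw [h3] at h1
      rw [h4] at h2
      have h5 : e (2 * i) = 4 * e (2 * (i + 1)) + 2 := by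
        rw [show 2 * (i + 1) = 2 * i + 1 + 1 by ring]
        push_cast at h1 h2
        linarith
      rw [h5]; ring
  have hj := hpow j le_rfl
  have he0 : e 0 = s.count 0 + N := by simp [he, kspmA]
  have hcb := kspm_count_bound N s σ h
  have hp : (0 : ℤ) < 4 ^ j := by positivity
  have hnn : 0 ≤ e (2 * j) := by
    by_contra hlt
    have : 3 * e (2 * j) + 2 ≤ -1 := by omega
    have : (4 : ℤ) ^ j * (3 * e (2 * j) + 2) ≤ 0 := by nlinarith
    omega
  have : (4 : ℤ) ^ j * 2 ≤ 4 ^ j * (3 * e (2 * j) + 2) := by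
    apply mul_le_mul_of_nonneg_left _ hp.le
    omega
  zify
  zify at hcb
  linarith

theorem kspm_Lp_bound (n : ℕ) :
    Lp 3 (n + 1) ≤ 1 ∨ ∃ j : ℕ, Lp 3 (n + 1) ≤ 2 * j ∧ 4 * 4 ^ j ≤ 9 * n + 4 := by
  obtain ⟨hr, hs⟩ := kspm_piN_spec n
  have hs' := (kspm_piN_spec (n + 1)).2
  have hex := kspm_avalanche_exec n
  by_cases h0 : piN 3 n 0 = 2
  · right
    have hbr : ∃ j, ¬ (piN 3 n (2 * j) = 2 ∧ piN 3 n (2 * j + 1) = 0) := by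
      obtain ⟨M, hM⟩ := kspm_supp_piN n
      refine ⟨M, ?_⟩
      rw [hM (2 * M) (by omega)]
      omega
    have hpat : ∀ i < Nat.find hbr, piN 3 n (2 * i) = 2 ∧ piN 3 n (2 * i + 1) = 0 := by
      intro i hi
      have := Nat.find_min hbr hi
      exact not_not.1 this
    refine ⟨Nat.find hbr, ?_, ?_⟩
    · exact Nat.sInf_le (kspm_dense _ hs _ _ hex hs' h0 _ hpat (Nat.find_spec hbr))
    · obtain ⟨t, ht⟩ := (kspm_reaches_iff _ _).1 hr
      exact kspm_pow_bound n t _ ht _ hpat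
  · left
    apply Nat.sInf_le
    have hnil : avalanche 3 (n + 1) = [] := by
      cases hav : avalanche 3 (n + 1) with
      | nil => rfl
      | cons a s =>
        rw [hav] at hex
        have h1 := hex.1
        have h2 := hs a
        unfold addGrain at h1
        split_ifs at h1 with ha
        · subst ha; omega
        · omega
    refine ⟨0, ?_, ?_⟩
    · intro i h1 h2; omega
    · intro i _; rw [hnil]; simp

theorem kspm_Lgdc_bound (N : ℕ) :
    Lgdc 3 N ≤ 1 ∨ ∃ j : ℕ, Lgdc 3 N ≤ 2 * j ∧ 4 * 4 ^ j + 5 ≤ 9 * N := by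
  by_cases hN : N = 0
  · left; subst hN; simp [Lgdc]
  · have hne : (Finset.Icc 1 N).Nonempty := ⟨1, by simp; omega⟩
    obtain ⟨k, hk, hk2⟩ := Finset.exists_mem_eq_sup _ hne (Lp 3)
    rw [Finset.mem_Icc] at hk
    have hL : Lgdc 3 N = Lp 3 k := hk2
    rw [hL]
    obtain ⟨n, rfl⟩ : ∃ n, k = n + 1 := ⟨k - 1, by omega⟩
    rcases kspm_Lp_bound n with h | ⟨j, h1, h2⟩
    · exact Or.inl h
    · exact Or.inr ⟨j, h1, by omega⟩

/-- For `D = 3` and every `N ≥ 9`, the global density column satisfies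
`L(3,N) ≤ 2·log₄((9N − 5)/4)`; in particular `L(3,N) = O(log N)`. -/
theorem global_density_column_log :
    (∀ N : ℕ, 9 ≤ N →
      (Lgdc 3 N : ℝ) ≤ 2 * Real.logb 4 ((9 * (N : ℝ) - 5) / 4)) ∧
    ∃ C : ℝ, 0 < C ∧ ∀ N : ℕ, 1 ≤ N →
      (Lgdc 3 N : ℝ) ≤ C * Real.log (N + 2) := by
  refine ⟨?_, 4, by norm_num, ?_⟩
  · intro N hN
    have hNr : (9 : ℝ) ≤ N := by exact_mod_cast hN
    have hpos : 0 < (9 * (N : ℝ) - 5) / 4 := by linarith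
    rcases kspm_Lgdc_bound N with h | ⟨j, h1, h2⟩
    · have h3 : (Lgdc 3 N : ℝ) ≤ 1 := by exact_mod_cast h
      have h4 : (1 : ℝ) ≤ Real.logb 4 ((9 * (N : ℝ) - 5) / 4) := by
        rw [Real.le_logb_iff_rpow_le (by norm_num) hpos, Real.rpow_one]
        linarith
      linarith
    · have h3 : (Lgdc 3 N : ℝ) ≤ 2 * j := by exact_mod_cast h1
      have h5 : 4 * (4 : ℝ) ^ j + 5 ≤ 9 * N := by exact_mod_cast h2
      have h4 : (j : ℝ) ≤ Real.logb 4 ((9 * (N : ℝ) - 5) / 4) := by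
        rw [Real.le_logb_iff_rpow_le (by norm_num) hpos, Real.rpow_natCast]
        linarith
      linarith
  · intro N hN
    have hNr : (1 : ℝ) ≤ N := by exact_mod_cast hN
    have hlog2 : 0.6931471803 < Real.log 2 := Real.log_two_gt_d9
    have hmono : Real.log 2 ≤ Real.log ((N : ℝ) + 2) :=
      Real.log_le_log (by norm_num) (by linarith)
    rcases kspm_Lgdc_bound N with h | ⟨j, h1, h2⟩
    · have h3 : (Lgdc 3 N : ℝ) ≤ 1 := by exact_mod_cast h
      linarith
    · have h3 : (Lgdc 3 N : ℝ) ≤ 2 * j := by exact_mod_cast h1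
      have h5 : 4 * (4 : ℝ) ^ j + 5 ≤ 9 * N := by exact_mod_cast h2
      have h6 : (4 : ℝ) ^ j ≤ ((N : ℝ) + 2) ^ 2 := by nlinarith
      have h7 := Real.log_le_log (by positivity) h6
      rw [Real.log_pow, Real.log_pow, show (4 : ℝ) = 2 ^ 2 by norm_num, Real.log_pow] at h7
      push_cast at h7
      have h8 : (j : ℝ) * 1 ≤ j * (2 * Real.log 2) :=
        mul_le_mul_of_nonneg_left (by linarith) (by positivity)
      linarith
end

section
/- Let s^k = (s^k_1,…,s^k_T) be the k-th avalanche and (p_1,…,p_q) its sequence of peaks in increasing order. Assume there is a column l such that every column of the interval [l, l+D−2] occurs in s^k. Then: (i) for every column p ≥ l+D−1, p is a peak of s^k if and only if π(k−1)_p = D−1 and there exists j with p_j < p ≤ p_j + D−1; (ii) for every j ≤ q and every time t with s^k_t = p_j and p_j ≥ l+D−1, one has T ≥ t + p_j − p_{j−1} − 1 and, for every t' with t < t' ≤ t + p_j − p_{j−1} − 1, s^k_{t'} = s^k_{t'−1} − 1. -/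
open scoped Classical

namespace KS

theorem exec_append (D : ℕ) (a b : List ℕ) (σ τ : Config) :
    Exec D σ (a ++ b) τ ↔ ∃ ρ, Exec D σ a ρ ∧ Exec D ρ b τ := by
  induction a generalizing σ with
  | nil => simp [Exec]
  | cons x a ih => simp [Exec, ih, and_assoc]

theorem exec_det {D : ℕ} {s : List ℕ} {σ τ τ' : Config}
    (h : Exec D σ s τ) (h' : Exec D σ s τ') : τ = τ' := by
  induction s generalizing σ with
  | nil => simp only [Exec] at h h'; rw [h, h']
  | cons x a ih => exact ih h.2 h'.2

theorem reaches_of_exec {D : ℕ} {s : List ℕ} {σ τ : Config}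
    (h : Exec D σ s τ) : Reaches D σ τ := by
  induction s generalizing σ with
  | nil => simp only [Exec] at h; rw [h]; exact Relation.ReflTransGen.refl
  | cons x a ih => exact Relation.ReflTransGen.head ⟨x, h.1, rfl⟩ (ih h.2)

theorem exec_of_reaches {D : ℕ} {σ τ : Config}
    (h : Reaches D σ τ) : ∃ s, Exec D σ s τ := by
  induction h with
  | refl => exact ⟨[], rfl⟩
  | tail _ h2 ih =>
    obtain ⟨s, hs⟩ := ih
    obtain ⟨i, hi, e⟩ := h2
    exact ⟨s ++ [i], (exec_append _ _ _ _ _).2 ⟨_, hs, hi, e⟩⟩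

theorem fire_ge {D : ℕ} {σ : Config} {i j : ℕ} (h : i ≠ j) : σ j ≤ fireAt D σ i j := by
  unfold fireAt; split_ifs <;> omega

theorem fire_comm {D : ℕ} (hD : 2 ≤ D) {σ : Config} {i j : ℕ} (h : i ≠ j) (hi : D ≤ σ i)
    (hj : D ≤ σ j) : fireAt D (fireAt D σ i) j = fireAt D (fireAt D σ j) i := by
  funext x
  unfold fireAt
  by_cases h1 : x = i
  · subst h1
    simp [h]
    split_ifs <;> omega
  · by_cases h2 : x = j
    · subst h2
      simp [h1]
      split_ifs <;> omega
    · simp [h1, h2]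
      split_ifs <;> omega

theorem exec_fire {D : ℕ} (hD : 2 ≤ D) {s : List ℕ} {σ τ : Config} {i : ℕ} (hi : D ≤ σ i)
    (h : Exec D σ s τ) (hτ : Stable D τ) : ∃ s', Exec D (fireAt D σ i) s' τ := by
  induction s generalizing σ with
  | nil =>
    simp only [Exec] at h; subst h
    exact absurd (hτ i) (by omega)
  | cons j a ih =>
    by_cases e : j = i
    · subst e; exact ⟨a, h.2⟩
    · obtain ⟨s', hs'⟩ := ih (le_trans hi (fire_ge e)) h.2
      rw [fire_comm hD e h.1 hi] at hs'
      exact ⟨j :: s', le_trans h.1 (fire_ge (Ne.symm e)), hs'⟩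

theorem stable_unique {D : ℕ} (hD : 2 ≤ D) {s s' : List ℕ} {σ τ τ' : Config}
    (h : Exec D σ s τ) (hτ : Stable D τ) (h' : Exec D σ s' τ') (hτ' : Stable D τ') :
    τ = τ' := by
  induction s generalizing σ s' with
  | nil =>
    simp only [Exec] at h; subst h
    cases s' with
    | nil => simp only [Exec] at h'; rw [h']
    | cons j a => exact absurd (hτ j) (by have := h'.1; omega)
  | cons j a ih =>
    obtain ⟨s2, hs2⟩ := exec_fire hD h.1 h' hτ'
    exact ih h.2 hs2

theorem exec_count {D : ℕ} (hD : 2 ≤ D) {s : List ℕ} {σ τ : Config}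
    (h : Exec D σ s τ) (i : ℕ) :
    τ i + D * s.count i = σ i + (D - 1) * s.count (i + 1) +
      (if D - 1 ≤ i then s.count (i - (D - 1)) else 0) := by
  induction s generalizing σ with
  | nil => simp only [Exec] at h; simp [h]
  | cons j a ih =>
    have := ih h.2
    have h1 := h.1
    simp only [List.count_cons, mul_add]
    have e : fireAt D σ j i + (if j = i then D else 0) =
        σ i + (if j = i + 1 then D - 1 else 0) + (if D - 1 ≤ i ∧ j = i - (D - 1) then 1 else 0) := by
      unfold fireAt
      by_cases h2 : i = j
      · subst h2
        simp
        split_ifs <;> omega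
      · simp [h2, Ne.symm h2]
        split_ifs <;> omega
    simp only [beq_iff_eq]
    split_ifs at * <;> simp_all <;> omega

theorem fire_addGrain {D : ℕ} {σ : Config} {i : ℕ} (h : D ≤ σ i) :
    fireAt D (addGrain σ) i = addGrain (fireAt D σ i) := by
  funext x
  simp only [fireAt, addGrain]
  by_cases h1 : x = i
  · subst h1
    simp only [if_true]
    split_ifs <;> omega
  · simp only [h1, if_false]
    split_ifs <;> omega

theorem exec_addGrain {D : ℕ} {s : List ℕ} {σ τ : Config} (h : Exec D σ s τ) :
    Exec D (addGrain σ) s (addGrain τ) := by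
  induction s generalizing σ with
  | nil => simp only [Exec] at *; rw [h]
  | cons j a ih =>
    refine ⟨le_trans h.1 (by unfold addGrain; split_ifs <;> omega), ?_⟩
    rw [fire_addGrain h.1]
    exact ih h.2

theorem exec_supp {D : ℕ} {s : List ℕ} {σ τ : Config} (h : Exec D σ s τ)
    (hs : ∃ M, ∀ i, M < i → σ i = 0) : ∃ M, ∀ i, M < i → τ i = 0 := by
  induction s generalizing σ with
  | nil => simp only [Exec] at *; rw [h]; exact hs
  | cons j a ih =>
    refine ih h.2 ?_
    obtain ⟨M, hM⟩ := hs
    refine ⟨M + j + D, fun i hi => ?_⟩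
    have := hM i (by omega)
    unfold fireAt
    split_ifs <;> omega

/-- enabledness of column `i` in terms of the list `F` of fired columns. -/
def En (D : ℕ) (Q : Config) (F : List ℕ) (i : ℕ) : Prop :=
  i ∉ F ∧ ((i + 1 ∈ F ∧ (1 ≤ Q i ∨ ∃ j ∈ F, j + (D - 1) = i)) ∨
    (D - 1 ≤ Q i ∧ ∃ j ∈ F, j + (D - 1) = i) ∨ D ≤ Q i)

theorem en_iff {D : ℕ} (hD : 2 ≤ D) {s : List ℕ} {π τ : Config} (hπ : Stable D π)
    (hs : s.Nodup) (h : Exec D (addGrain π) s τ) (i : ℕ) :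
    D ≤ τ i ↔ En D (addGrain π) s i := by
  have h1 := exec_count hD h i
  have h2 := hπ i
  have hc : ∀ j, s.count j = if j ∈ s then 1 else 0 := fun j => by
    split_ifs with hj
    · exact List.count_eq_one_of_mem hs hj
    · exact List.count_eq_zero_of_not_mem hj
  simp only [hc] at h1
  have hb : (∃ j ∈ s, j + (D - 1) = i) ↔ (D - 1 ≤ i ∧ i - (D - 1) ∈ s) := by
    constructor
    · rintro ⟨j, hj, e⟩
      refine ⟨by omega, ?_⟩
      have : i - (D - 1) = j := by omega
      rwa [this]
    · rintro ⟨a, b⟩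
      exact ⟨_, b, by omega⟩
  unfold En
  rw [hb]
  have h3 : addGrain π i ≤ D - (if D - 1 ≤ i then 1 else 0) := by
    unfold addGrain; split_ifs <;> omega
  by_cases c1 : i ∈ s <;> by_cases c2 : i + 1 ∈ s <;> by_cases c3 : D - 1 ≤ i <;>
    by_cases c4 : i - (D - 1) ∈ s <;> simp [c1, c2, c3, c4] at h1 h3 ⊢ <;> omega

theorem exec_nodup {D : ℕ} (hD : 2 ≤ D) {s : List ℕ} {π τ : Config} (hπ : Stable D π)
    (h : Exec D (addGrain π) s τ) : s.Nodup := by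
  induction s using List.reverseRecOn generalizing τ with
  | nil => simp
  | append_singleton a x ih =>
    obtain ⟨ρ, h1, h2⟩ := (exec_append _ _ _ _ _).1 h
    have hn := ih h1
    have := ((en_iff hD hπ hn h1 x).1 h2.1).1
    rw [List.nodup_append]
    refine ⟨hn, by simp, ?_⟩
    grind

theorem exec_bound {D : ℕ} (hD : 2 ≤ D) {s : List ℕ} {π τ : Config} (hπ : Stable D π)
    {M : ℕ} (hM : ∀ i, M < i → π i = 0)
    (h : Exec D (addGrain π) s τ) : ∀ x ∈ s, x ≤ M := by
  induction s using List.reverseRecOn generalizing τ with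
  | nil => simp
  | append_singleton a x ih =>
    obtain ⟨ρ, h1, h2⟩ := (exec_append _ _ _ _ _).1 h
    have hn := ih h1
    have he := ((en_iff hD hπ (exec_nodup hD hπ h1) h1 x).1 h2.1)
    intro y hy
    rcases List.mem_append.1 hy with hy | hy
    · exact hn y hy
    · simp at hy; subst hy
      by_contra hc
      push Not at hc
      have q : addGrain π y = 0 := by
        unfold addGrain; rw [hM y hc]; split_ifs <;> omega
      have : y + 1 ∉ a := fun hh => by have := hn _ hh; omega
      rcases he.2 with h | h | h
      · exact this h.1
      · omega
      · omega

def Gr (D : ℕ) (σ : Config) (s : List ℕ) (τ : Config) : Prop :=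
  Exec D σ s τ ∧ ∀ a x b ρ, s = a ++ x :: b → Exec D σ a ρ → ∀ y, D ≤ ρ y → x ≤ y

theorem gr_exists {D : ℕ} (hD : 2 ≤ D) {π : Config} (hπ : Stable D π)
    {M : ℕ} (hM : ∀ i, M < i → π i = 0) :
    ∃ s τ, Gr D (addGrain π) s τ ∧ Stable D τ := by
  by_contra hno
  have key : ∀ n, ∃ s τ, Gr D (addGrain π) s τ ∧ s.length = n := by
    intro n
    induction n with
    | zero => exact ⟨[], _, ⟨rfl, by simp⟩, rfl⟩
    | succ n ih =>
      obtain ⟨s, τ, hs, hl⟩ := ih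
      have : ∃ y, D ≤ τ y := by
        by_contra hc
        push Not at hc
        exact hno ⟨s, τ, hs, hc⟩
      have hf := Nat.find_spec this
      refine ⟨s ++ [Nat.find this], _, ⟨(exec_append _ _ _ _ _).2 ⟨τ, hs.1, hf, rfl⟩, ?_⟩,
        by simp [hl]⟩
      intro a x b ρ e ha y hy
      rcases List.eq_nil_or_concat b with hb | ⟨b', z, hb⟩
      · subst hb
        obtain ⟨e1, e2⟩ := List.append_inj' e rfl
        subst e1
        have e3 : Nat.find this = x := by simpa using e2
        rw [← e3, Nat.find_le_iff]
        rw [exec_det ha hs.1] at hy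
        exact ⟨y, le_rfl, hy⟩
      · subst hb
        have e' : s ++ [Nat.find this] = (a ++ x :: b') ++ [z] := by simpa using e
        have := (List.append_inj' e' rfl).1
        exact hs.2 a x b' ρ this ha y hy
  obtain ⟨s, τ, hs, hl⟩ := key (M + 2)
  have hn := exec_nodup hD hπ hs.1
  have hb := exec_bound hD hπ hM hs.1
  have : s.toFinset ⊆ Finset.range (M + 1) := by
    intro x hx
    have := hb x (by simpa using hx)
    simp; omega
  have := Finset.card_le_card this
  rw [List.toFinset_card_of_nodup hn] at this
  simp at this
  omega

theorem gr_lex {D : ℕ} {s s' : List ℕ} {σ τ : Config} (h : Gr D σ s τ) (hτ : Stable D τ)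
    (h' : Exec D σ s' τ) : s = s' ∨ List.Lex (· < ·) s s' := by
  induction s generalizing σ s' with
  | nil =>
    have := h.1
    simp only [Exec] at this; subst this
    cases s' with
    | nil => left; rfl
    | cons j a => exact absurd (hτ j) (by have := h'.1; omega)
  | cons x a ih =>
    cases s' with
    | nil =>
      simp only [Exec] at h'; subst h'
      exact absurd (hτ x) (by have := h.1.1; omega)
    | cons y b =>
      have hxy : x ≤ y := h.2 [] x a σ rfl rfl y h'.1
      rcases hxy.lt_or_eq with hlt | he
      · right; exact List.Lex.rel hlt
      · subst he
        have hg : Gr D (fireAt D σ x) a τ := by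
          refine ⟨h.1.2, fun a' z b' ρ e he => ?_⟩
          exact h.2 (x :: a') z b' ρ (by simp [e]) ⟨h.1.1, he⟩
        rcases ih hg h'.2 with e | e
        · left; rw [e]
        · right; exact List.Lex.cons e

theorem lex_asymm {s s' : List ℕ} (h : List.Lex (· < ·) s s') (h' : List.Lex (· < ·) s' s) :
    False := by
  induction h with
  | nil => cases h'
  | cons _ ih =>
    cases h' with
    | cons h => exact ih h
    | rel h => omega
  | rel h =>
    cases h' with
    | cons h => omega
    | rel h => omega

theorem piN_spec {D : ℕ} (hD : 2 ≤ D) (k : ℕ) :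
    (∃ s, Exec D (grains k) s (piN D k)) ∧ Stable D (piN D k) := by
  have main : ∃ μ, Reaches D (grains k) μ ∧ Stable D μ := by
    induction k with
    | zero =>
      refine ⟨grains 0, Relation.ReflTransGen.refl, fun i => ?_⟩
      unfold grains; split_ifs <;> omega
    | succ k ih =>
      obtain ⟨μ, h1, h2⟩ := ih
      obtain ⟨s, hs⟩ := exec_of_reaches h1
      obtain ⟨M, hM⟩ := exec_supp hs ⟨0, fun i hi => by unfold grains; split_ifs <;> omega⟩
      obtain ⟨t, τ, ht, hτ⟩ := gr_exists hD h2 hM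
      refine ⟨τ, ?_, hτ⟩
      have e : addGrain (grains k) = grains (k + 1) := by
        funext x; unfold addGrain grains; split_ifs <;> rfl
      rw [← e]
      exact reaches_of_exec ((exec_append _ _ _ _ _).2 ⟨_, exec_addGrain hs, ht.1⟩)
  have := Classical.epsilon_spec main
  exact ⟨exec_of_reaches this.1, this.2⟩

theorem avalanche_gr {D : ℕ} (hD : 2 ≤ D) (k : ℕ) (hk : 1 ≤ k) :
    Gr D (addGrain (piN D (k - 1))) (avalanche D k) (piN D k) := by
  obtain ⟨⟨s, hs⟩, hst⟩ := piN_spec hD (k - 1)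
  obtain ⟨⟨s2, hs2⟩, hst2⟩ := piN_spec hD k
  obtain ⟨M, hM⟩ := exec_supp hs ⟨0, fun i hi => by unfold grains; split_ifs <;> omega⟩
  obtain ⟨t, τ, ht, hτ⟩ := gr_exists hD hst hM
  have e : addGrain (grains (k - 1)) = grains k := by
    funext x; unfold addGrain grains; split_ifs <;> omega
  have h3 : Exec D (grains k) (s ++ t) τ := by
    rw [← e]
    exact (exec_append _ _ _ _ _).2 ⟨_, exec_addGrain hs, ht.1⟩
  have e2 := stable_unique hD h3 hτ hs2 hst2
  subst e2
  have hP : ∃ s, Exec D (addGrain (piN D (k - 1))) s (piN D k) ∧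
    ∀ s', Exec D (addGrain (piN D (k - 1))) s' (piN D k) →
      s = s' ∨ List.Lex (· < ·) s s' := ⟨t, ht.1, fun s' h' => gr_lex ht hτ h'⟩
  have h5 := Classical.epsilon_spec hP
  change Exec D _ (avalanche D k) _ ∧ ∀ s', _ → avalanche D k = s' ∨ List.Lex (· < ·) (avalanche D k) s' at h5
  have h6 : avalanche D k = t := by
    rcases h5.2 t ht.1 with h | h
    · exact h
    · rcases gr_lex ht hτ h5.1 with h' | h'
      · exact h'.symm
      · exact (lex_asymm h h').elim
  rw [h6]; exact ht

theorem avalanche_en {D : ℕ} (hD : 2 ≤ D) (k : ℕ) (hk : 1 ≤ k) :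
    (∀ a x b, avalanche D k = a ++ x :: b → En D (addGrain (piN D (k - 1))) a x ∧
      ∀ y, En D (addGrain (piN D (k - 1))) a y → x ≤ y) ∧
    ∀ y, ¬ En D (addGrain (piN D (k - 1))) (avalanche D k) y := by
  have hg := avalanche_gr hD k hk
  have hst := (piN_spec hD (k - 1)).2
  have hst2 := (piN_spec hD k).2
  constructor
  · intro a x b e
    have h1 := hg.1
    rw [e] at h1
    obtain ⟨ρ, ha, hx⟩ := (exec_append _ _ _ _ _).1 h1
    have hiff := en_iff hD hst (exec_nodup hD hst ha) ha
    exact ⟨(hiff x).1 hx.1, fun y hy => hg.2 a x b ρ e ha y ((hiff y).2 hy)⟩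
  · intro y hy
    have := (en_iff hD hst (exec_nodup hD hst hg.1) hg.1 y).2 hy
    have := hst2 y
    omega

/-- abstract avalanche data -/
structure Av (D : ℕ) (Q : Config) (s : List ℕ) : Prop where
  hD : 2 ≤ D
  hQ : ∀ i, 1 ≤ i → Q i < D
  h1 : ∀ a x b, s = a ++ x :: b → En D Q a x ∧ ∀ y, En D Q a y → x ≤ y
  h2 : ∀ y, ¬ En D Q s y

variable {D : ℕ} {Q : Config} {s : List ℕ}

theorem Av.stuck (A : Av D Q s) {a b : List ℕ} (e : s = a ++ b) {c : ℕ} (hc : c ∈ a)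
    (hn : ∀ u, u < c → ¬ En D Q a u) : ∀ u, u < c → u ∉ b := by
  induction b generalizing a with
  | nil => simp
  | cons x b ih =>
    obtain ⟨hx, -⟩ := A.h1 a x b e
    have hxc : c < x := by
      have : ¬ x < c := fun h => hn x h hx
      have : x ≠ c := fun h => hx.1 (h ▸ hc)
      omega
    have := ih (a := a ++ [x]) (by simp [e]) (by simp [hc]) ?_
    · intro u hu
      have := this u hu
      simp; exact ⟨by omega, this⟩
    · intro u hu hen
      apply hn u hu
      have hD := A.hD
      have k1 : ∀ v, v < x → v ∈ a ++ [x] → v ∈ a := by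
        intro v hv hm
        rcases List.mem_append.1 hm with h | h
        · exact h
        · simp at h; omega
      refine ⟨fun h => hen.1 (by simp [h]), ?_⟩
      rcases hen.2 with ⟨g1, g2⟩ | ⟨g1, j, g2, g3⟩ | g
      · left
        refine ⟨k1 _ (by omega) g1, ?_⟩
        rcases g2 with g | ⟨j, g2, g3⟩
        · left; exact g
        · right; exact ⟨j, k1 _ (by omega) g2, g3⟩
      · right; left; exact ⟨g1, j, k1 _ (by omega) g2, g3⟩
      · right; right; exact g

theorem Av.gap (A : Av D Q s) {a b : List ℕ} (e : s = a ++ b) {c x : ℕ} (hc : 1 ≤ c)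
    (hx : x ∈ a) (hxc : c ≤ x) : ∃ y ∈ a, y < c ∧ c ≤ y + (D - 1) := by
  induction a using List.reverseRecOn generalizing b x with
  | nil => simp at hx
  | append_singleton a z ih =>
    have e' : s = a ++ z :: b := by simp [e]
    by_cases h : ∃ w ∈ a, c ≤ w
    · obtain ⟨w, hw, hcw⟩ := h
      obtain ⟨y, hy, h⟩ := ih e' hw hcw
      exact ⟨y, by simp [hy], h⟩
    · push Not at h
      have hxz : x = z := by
        rcases List.mem_append.1 hx with g | g
        · have := h x g; omega
        · simpa using g
      subst hxz
      have hen := (A.h1 a x b e').1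
      have hq := A.hQ x (by omega)
      rcases hen.2 with ⟨g1, g2⟩ | ⟨g1, j, g2, g3⟩ | g
      · have := h _ g1; omega
      · exact ⟨j, by simp [g2], h j g2, by omega⟩
      · omega

theorem Av.dense (A : Av D Q s) {l : ℕ} (hl : ∀ i, l ≤ i → i ≤ l + D - 2 → i ∈ s)
    {a b : List ℕ} (e : s = a ++ b) {x : ℕ} (hx : x ∈ a)
    (hn : ∀ u, u < x → ¬ En D Q a u) : ∀ i, l ≤ i → i ≤ x → i ∈ a := by
  intro i
  induction i using Nat.strong_induction_on with
  | _ i ih =>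
  intro hli hix
  by_contra hia
  have hD := A.hD
  have hne : i ≠ x := fun h => hia (h ▸ hx)
  have hst := A.stuck e hx hn i (by omega)
  have his : i ∉ s := by rw [e]; simp [hia, hst]
  have hbig : l + D - 1 ≤ i := by
    by_contra hc
    exact his (hl i hli (by omega))
  have hex : ∃ c, i < c ∧ c ∈ a := ⟨x, by omega, hx⟩
  have hf := Nat.find_spec hex
  have hmin := fun m => Nat.find_min hex (m := m)
  have hcx := Nat.find_min' hex (m := x) ⟨by omega, hx⟩
  generalize Nat.find hex = c at *
  obtain ⟨hic, hca⟩ := hf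
  obtain ⟨y, hy, hy1, hy2⟩ := A.gap e (c := c) (by omega) hca le_rfl
  have hyi : y < i := by
    have : y ≠ i := fun h => hia (h ▸ hy)
    have := hmin y hy1
    by_contra hcc
    exact this ⟨by omega, hy⟩
  have hback : c - D ∈ a := ih (c - D) (by omega) (by omega) (by omega)
  refine hn (c - 1) (by omega) ⟨fun h => ?_, Or.inl ⟨?_, Or.inr ⟨c - D, hback, by omega⟩⟩⟩
  · by_cases h' : c - 1 = i
    · exact hia (h' ▸ h)
    · exact hmin (c - 1) (by omega) ⟨by omega, h⟩
  · have : c - 1 + 1 = c := by omega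
    rwa [this]

theorem isPeak_iff {p : ℕ} : IsPeak s p ↔ ∃ a b, s = a ++ p :: b ∧ ∀ y ∈ a, y < p := by
  constructor
  · rintro ⟨t, ht, h⟩
    refine ⟨s.take t, s.drop (t + 1), ?_, ?_⟩
    · rw [← ht]; simp
    · intro y hy
      obtain ⟨i, hi, rfl⟩ := List.mem_take_iff_getElem.1 hy
      exact h ⟨i, by omega⟩ (by simp [Fin.lt_def]; omega)
  · rintro ⟨a, b, rfl, h⟩
    refine ⟨⟨a.length, by simp⟩, by simp, ?_⟩
    intro t' ht'
    apply h
    have : t'.1 < a.length := ht'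
    simp [List.getElem_append_left this]

theorem Av.nodup (A : Av D Q s) : s.Nodup := by
  have : ∀ a b, s = a ++ b → a.Nodup := by
    intro a
    induction a using List.reverseRecOn with
    | nil => simp
    | append_singleton a x ih =>
      intro b e
      have e' : s = a ++ x :: b := by simp [e]
      have := ih _ e'
      have := (A.h1 a x b e').1.1
      rw [List.nodup_append]
      grind
  exact this s [] (by simp)

/-- first element `≥ p`. -/
theorem first_ge (p : ℕ) (s : List ℕ) (h : ∃ x ∈ s, p ≤ x) :
    ∃ a r b, s = a ++ r :: b ∧ p ≤ r ∧ ∀ y ∈ a, y < p := by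
  induction s with
  | nil => simp at h
  | cons x s ih =>
    by_cases hx : p ≤ x
    · exact ⟨[], x, s, rfl, hx, by simp⟩
    · obtain ⟨a, r, b, e, h1, h2⟩ := ih (by
        obtain ⟨y, hy, hpy⟩ := h
        rcases List.mem_cons.1 hy with g | g
        · omega
        · exact ⟨y, g, hpy⟩)
      refine ⟨x :: a, r, b, by simp [e], h1, ?_⟩
      intro y hy
      rcases List.mem_cons.1 hy with g | g
      · omega
      · exact h2 y g

/-- a maximum of a nonempty prefix is a peak. -/
theorem max_isPeak {a b : List ℕ} (e : s = a ++ b) {m : ℕ} (hm : m ∈ a) (hmax : ∀ y ∈ a, y ≤ m) :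
    IsPeak s m := by
  obtain ⟨a1, r, b1, e1, h1, h2⟩ := first_ge m a ⟨m, hm, le_rfl⟩
  have : r = m := le_antisymm (hmax r (by simp [e1])) h1
  subst this
  exact isPeak_iff.2 ⟨a1, b1 ++ b, by simp [e, e1], h2⟩

theorem exists_max {a : List ℕ} {j : ℕ} (hj : j ∈ a) : ∃ m ∈ a, ∀ y ∈ a, y ≤ m := by
  have hne : a.toFinset.Nonempty := ⟨j, by simpa using hj⟩
  refine ⟨a.toFinset.max' hne, by simpa using a.toFinset.max'_mem hne, fun y hy => ?_⟩
  exact a.toFinset.le_max' y (by simpa using hy)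

/-- a peak `p ≥ 1` is fired thanks to `p-(D-1)`. -/
theorem Av.peak_back (A : Av D Q s) {a b : List ℕ} {p : ℕ} (e : s = a ++ p :: b)
    (hp : 1 ≤ p) (h : ∀ y ∈ a, y < p) : Q p = D - 1 ∧ ∃ j ∈ a, j + (D - 1) = p := by
  have hen := (A.h1 a p b e).1
  have hq := A.hQ p hp
  rcases hen.2 with ⟨g1, g2⟩ | ⟨g1, g⟩ | g
  · have := h _ g1; omega
  · exact ⟨by omega, g⟩
  · omega

theorem Av.part1 (A : Av D Q s) {l : ℕ} (hl : ∀ i, l ≤ i → i ≤ l + D - 2 → i ∈ s)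
    (p : ℕ) (hp : l + D - 1 ≤ p) :
    IsPeak s p ↔ (Q p = D - 1 ∧ ∃ p', IsPeak s p' ∧ p' < p ∧ p ≤ p' + (D - 1)) := by
  have hD := A.hD
  constructor
  · intro hpk
    obtain ⟨a, b, e, h⟩ := isPeak_iff.1 hpk
    obtain ⟨hq, j, hj, hjp⟩ := A.peak_back e (by omega) h
    refine ⟨hq, ?_⟩
    obtain ⟨m, hm, hmax⟩ := exists_max hj
    exact ⟨m, max_isPeak e hm hmax, h m hm, by have := hmax j hj; omega⟩
  · rintro ⟨hq, p', hp', hlt, hle⟩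
    obtain ⟨a', b', e', h'⟩ := isPeak_iff.1 hp'
    by_cases hex : ∃ x ∈ s, p ≤ x
    · obtain ⟨a, r, b, e, h1, h2⟩ := first_ge p s hex
      have hgr := A.h1 a r b e
      have hp'a : p' ∈ a := by
        by_contra hc
        have e3 := e.symm.trans e'
        rcases List.append_eq_append_iff.1 e3 with ⟨c, g1, g2⟩ | ⟨c, g1, g2⟩
        · cases c with
          | nil => simp at g2; omega
          | cons z c =>
            simp at g2
            have := h' r (by rw [g1, g2.1]; simp)
            omega
        · cases c with
          | nil => simp at g2; omega
          | cons z c =>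
            simp at g2
            exact hc (by rw [g1, g2.1]; simp)
      have hdense := A.dense hl e hp'a (fun u hu hen => by have := hgr.2 u hen; omega)
        (p - (D - 1)) (by omega) (by omega)
      have hen : En D Q a p := ⟨fun h => by have := h2 p h; omega,
        Or.inr (Or.inl ⟨by omega, _, hdense, by omega⟩)⟩
      have : r = p := le_antisymm (hgr.2 p hen) h1
      subst this
      exact isPeak_iff.2 ⟨a, b, e, h2⟩
    · exfalso
      have hdense := A.dense hl (a := s) (b := []) (by simp) (x := p') (by rw [e']; simp)
        (fun u _ => A.h2 u) (p - (D - 1)) (by omega) (by omega)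
      exact A.h2 p ⟨fun h => hex ⟨p, h, le_rfl⟩,
        Or.inr (Or.inl ⟨by omega, _, hdense, by omega⟩)⟩

theorem Av.cascade (A : Av D Q s) {l : ℕ} (hl : ∀ i, l ≤ i → i ≤ l + D - 2 → i ∈ s)
    {a b : List ℕ} {p p' : ℕ} (e : s = a ++ p :: b) (h : ∀ y ∈ a, y < p)
    (hp : l + D - 1 ≤ p) (hp' : p' ∈ a) (hmax : ∀ y ∈ a, y ≤ p') (m : ℕ) (hm : m < p - p') :
    a.length + m < s.length ∧ s.getD (a.length + m) 0 = p - m ∧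
      ∀ y, y ∈ s.take (a.length + m + 1) ↔ (y ∈ a ∨ (p - m ≤ y ∧ y ≤ p)) := by
  have hD := A.hD
  have hgr := A.h1 a p b e
  obtain ⟨hq, j, hj, hjp⟩ := A.peak_back e (by omega) h
  have hjp' := hmax j hj
  have hlt := h p' hp'
  induction m with
  | zero =>
    refine ⟨by simp [e], by simp [e], ?_⟩
    intro y
    have : s.take (a.length + 0 + 1) = a ++ [p] := by simp [e, List.take_append]
    rw [this, List.mem_append, List.mem_singleton]
    have : y = p ↔ (p - 0 ≤ y ∧ y ≤ p) := by omega
    rw [this]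
  | succ m ih =>
    obtain ⟨i1, i2, i3⟩ := ih (by omega)
    generalize hn : a.length + m + 1 = n at i3
    have es : s = s.take n ++ s.drop n := by simp
    have hsub : ∀ u, u < p - m - 1 → ¬ En D Q (s.take n) u := by
      intro u hu hen
      have k1 : ∀ v, v < p - m → v ∈ s.take n → v ∈ a := by
        intro v hv hm
        rcases (i3 v).1 hm with h | h
        · exact h
        · omega
      have : En D Q a u := by
        refine ⟨fun h => hen.1 ((i3 u).2 (Or.inl h)), ?_⟩
        rcases hen.2 with ⟨g1, g2⟩ | ⟨g1, j, g2, g3⟩ | g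
        · left
          refine ⟨k1 _ (by omega) g1, ?_⟩
          rcases g2 with g | ⟨j, g2, g3⟩
          · left; exact g
          · right; exact ⟨j, k1 _ (by omega) g2, g3⟩
        · right; left; exact ⟨g1, j, k1 _ (by omega) g2, g3⟩
        · right; right; exact g
      have := hgr.2 u this
      omega
    have hnot : p - m - 1 ∉ s.take n := by
      intro h
      rcases (i3 _).1 h with h | h
      · have := hmax _ h; omega
      · omega
    have hcin : p - m ∈ s.take n := (i3 _).2 (Or.inr ⟨le_rfl, by omega⟩)
    have hen : En D Q (s.take n) (p - m - 1) := by
      by_cases hb : p - m - 1 ≤ l + D - 2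
      · by_contra hc
        have hst := A.stuck es hcin (fun u hu => by
          by_cases hu' : u = p - m - 1
          · rw [hu']; exact hc
          · exact hsub u (by omega)) (p - m - 1) (by omega)
        have := hl (p - m - 1) (by omega) hb
        rw [es] at this
        rcases List.mem_append.1 this with g | g
        · exact hnot g
        · exact hst g
      · refine ⟨hnot, Or.inl ⟨?_, Or.inr ⟨p - m - D, ?_, by omega⟩⟩⟩
        · have : p - m - 1 + 1 = p - m := by omega
          rwa [this]
        · refine (i3 _).2 (Or.inl ?_)
          exact A.dense hl e hp' (fun u hu hen => by have := hgr.2 u hen; omega) _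
            (by omega) (by omega)
    have hlen : n < s.length := by
      by_contra hc
      rw [List.take_of_length_le (by omega)] at hen
      exact A.h2 _ hen
    have es2 : s = s.take n ++ s[n] :: s.drop (n + 1) := by simp
    have hg2 := A.h1 _ _ _ es2
    have hx : s[n] = p - m - 1 := by
      have h1 := hg2.2 _ hen
      have h2 : ¬ s[n] < p - m - 1 := fun h => hsub _ h hg2.1
      omega
    have hn' : a.length + (m + 1) = n := by omega
    refine ⟨hlen, ?_, ?_⟩
    · simp [List.getD_eq_getElem?_getD, hlen, hx]; omega
    · intro y
      rw [List.take_add_one]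
      simp only [List.mem_append, i3, List.getElem?_eq_getElem hlen, hx, Option.toList_some,
        List.mem_singleton]
      constructor
      · rintro ((g | g) | g)
        · left; exact g
        · right; omega
        · right; omega
      · rintro (g | g)
        · left; left; exact g
        · by_cases g' : y = p - m - 1
          · right; exact g'
          · left; right; omega

theorem Av.part2 (A : Av D Q s) {l : ℕ} (hl : ∀ i, l ≤ i → i ≤ l + D - 2 → i ∈ s) (p p' : ℕ)
    (hpk : IsPeak s p) (hp : l + D - 1 ≤ p) (hpk' : IsPeak s p') (hlt : p' < p)
    (hc : ∀ q, IsPeak s q → q < p → q ≤ p') (t : ℕ) (ht : 1 ≤ t) (htl : t ≤ s.length)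
    (hg : s.getD (t - 1) 0 = p) :
    t + (p - p') - 1 ≤ s.length ∧ ∀ t', t < t' → t' ≤ t + (p - p') - 1 →
      s.getD (t' - 1) 0 = s.getD (t' - 2) 0 - 1 := by
  have hD := A.hD
  obtain ⟨a, b, e, h⟩ := isPeak_iff.1 hpk
  obtain ⟨hq, j, hj, hjp⟩ := A.peak_back e (by omega) h
  obtain ⟨m, hm, hmax⟩ := exists_max hj
  have hmp' : m ≤ p' := hc m (max_isPeak e hm hmax) (h m hm)
  have hta : t - 1 = a.length := by
    have h1 : t - 1 < s.length := by omega
    have h2 : a.length < s.length := by simp [e]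
    refine (A.nodup.getElem_inj_iff (hi := h1) (hj := h2)).1 ?_
    have e1 : s[t - 1] = p := by
      rw [← hg, List.getD_eq_getElem?_getD, List.getElem?_eq_getElem h1]; rfl
    have e2 : s[a.length] = p := by simp [e]
    rw [e1, e2]
  have hcas := A.cascade hl e h hp hm hmax
  constructor
  · have := (hcas (p - p' - 1) (by omega)).1
    omega
  · intro t' h1 h2
    have c1 := (hcas (t' - 1 - a.length) (by omega)).2.1
    have c2 := (hcas (t' - 2 - a.length) (by omega)).2.1
    have e1 : a.length + (t' - 1 - a.length) = t' - 1 := by omega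
    have e2 : a.length + (t' - 2 - a.length) = t' - 2 := by omega
    rw [e1] at c1
    rw [e2] at c2
    rw [c1, c2]
    omega

theorem avalanche_av {D : ℕ} (hD : 2 ≤ D) (k : ℕ) (hk : 1 ≤ k) :
    Av D (addGrain (piN D (k - 1))) (avalanche D k) where
  hD := hD
  hQ := fun i hi => by
    have := (piN_spec hD (k - 1)).2 i
    unfold addGrain; split_ifs <;> omega
  h1 := (avalanche_en hD k hk).1
  h2 := (avalanche_en hD k hk).2

end KS

/-- Theorem (peak structure of avalanches). Let `s^k` be the `k`-th avalanche
and suppose every column of `[l, l+D−2]` occurs in it. Then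
(i) a column `p ≥ l+D−1` is a peak iff `π(k−1)_p = D−1` and `p` lies in
`(p', p'+D−1]` for some peak `p'`;
(ii) for consecutive peaks `p' < p` with `p ≥ l+D−1`, if `p` is fired at
(1-based) time `t`, then `T ≥ t + p − p' − 1` and for `t < t' ≤ t + p − p' − 1`,
`s^k_{t'} = s^k_{t'−1} − 1`. -/
theorem avalanche_peak_structure (D k : ℕ) (hD : 2 ≤ D) (hk : 1 ≤ k) (l : ℕ)
    (hl : ∀ i, l ≤ i → i ≤ l + D - 2 → i ∈ avalanche D k) :
    (∀ p, l + D - 1 ≤ p →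
      (IsPeak (avalanche D k) p ↔
        (piN D (k - 1) p = D - 1 ∧
          ∃ p', IsPeak (avalanche D k) p' ∧ p' < p ∧ p ≤ p' + (D - 1)))) ∧
    (∀ p p', IsPeak (avalanche D k) p → l + D - 1 ≤ p →
      IsPeak (avalanche D k) p' → p' < p →
      (∀ q, IsPeak (avalanche D k) q → q < p → q ≤ p') →
      ∀ t, 1 ≤ t → t ≤ (avalanche D k).length →
        (avalanche D k).getD (t - 1) 0 = p →
        t + (p - p') - 1 ≤ (avalanche D k).length ∧
        ∀ t', t < t' → t' ≤ t + (p - p') - 1 →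
          (avalanche D k).getD (t' - 1) 0 =
            (avalanche D k).getD (t' - 2) 0 - 1) := by
  have A := KS.avalanche_av hD k hk
  constructor
  · intro p hp
    have := A.part1 hl p hp
    have e : addGrain (piN D (k - 1)) p = piN D (k - 1) p := by
      unfold addGrain; rw [if_neg (by omega)]
    rwa [e] at this
  · exact A.part2 hl
end

section
/- Fix N, let L = L(D,N) and let Φ = (φ¹,…,φⁿ) be the sequence of long avalanches up to N. For each k with 1 ≤ k < n, let P^k (respectively P^{k+1}) be the set of peaks i of φ^k (respectively of φ^{k+1}) with i ≥ L + 2(D−1), and suppose P^k is nonempty. Then P^k \ {max P^k} = P^{k+1} ∩ [L + 2(D−1), max P^k), where [u,v) denotes the integer interval {u, u+1, …, v−1}. -/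
open scoped Classical

/-- Book-keeping of a strategy through the number of occurrences of each column. -/
def Bal (D : ℕ) (σ : Config) (s : List ℕ) (τ : Config) : Prop :=
  ∀ j, τ j + D * s.count j = σ j + (D - 1) * s.count (j + 1) +
    (if D - 1 ≤ j then s.count (j - (D - 1)) else 0)

/-- Every fired column is the least one that can be fired. -/
def Gr (D : ℕ) : Config → List ℕ → Prop
  | _, [] => True
  | σ, i :: s => (∀ j < i, σ j < D) ∧ Gr D (fireAt D σ i) s

theorem bal_of_exec {D : ℕ} (hD : 2 ≤ D) : ∀ (s : List ℕ) (σ τ : Config),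
    Exec D σ s τ → Bal D σ s τ := by
  intro s
  induction s with
  | nil =>
    intro σ τ h
    simp only [Exec] at h
    subst h
    intro j
    simp
  | cons i s ih =>
    intro σ τ h
    obtain ⟨h1, h2⟩ := h
    intro j
    have := ih _ _ h2 j
    simp only [fireAt] at this
    simp only [List.count_cons, beq_iff_eq, mul_add]
    split_ifs at this ⊢ <;> first | omega | (subst_vars; simp at *; omega)

theorem exec_append {D : ℕ} : ∀ (a b : List ℕ) (σ τ : Config),
    Exec D σ (a ++ b) τ ↔ ∃ ν, Exec D σ a ν ∧ Exec D ν b τ := by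
  intro a
  induction a with
  | nil => intro b σ τ; simp [Exec]
  | cons i a ih =>
    intro b σ τ
    simp only [List.cons_append, Exec, ih]
    constructor
    · rintro ⟨h, ν, h1, h2⟩; exact ⟨ν, ⟨h, h1⟩, h2⟩
    · rintro ⟨ν, ⟨h, h1⟩, h2⟩; exact ⟨h, ν, h1, h2⟩

theorem gr_split {D : ℕ} : ∀ (a b : List ℕ) (p : ℕ) (σ τ : Config),
    Exec D σ (a ++ p :: b) τ → Gr D σ (a ++ p :: b) →
    ∃ ν, Exec D σ a ν ∧ D ≤ ν p ∧ ∀ j < p, ν j < D := by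
  intro a
  induction a with
  | nil =>
    intro b p σ τ h g
    exact ⟨σ, rfl, h.1, g.1⟩
  | cons i a ih =>
    intro b p σ τ h g
    obtain ⟨ν, h1, h2⟩ := ih b p _ τ h.2 g.2
    exact ⟨ν, ⟨h.1, h1⟩, h2⟩

theorem fire_comm {D : ℕ} (hD : 2 ≤ D) (σ : Config) (i c : ℕ) (hic : c ≠ i) (hi : D ≤ σ i)
    (hc : D ≤ σ c) : fireAt D (fireAt D σ c) i = fireAt D (fireAt D σ i) c := by
  funext j
  simp only [fireAt]
  split_ifs <;> first | rfl | omega | (subst_vars; omega)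

theorem fire_ge {D : ℕ} (σ : Config) (i c : ℕ) (hic : i ≠ c) :
    σ i ≤ fireAt D σ c i := by
  simp only [fireAt]
  split_ifs <;> omega

theorem exec_front {D : ℕ} (hD : 2 ≤ D) (μ : Config) (hμ : Stable D μ) :
    ∀ (s : List ℕ) (σ : Config) (i : ℕ), Exec D σ s μ → D ≤ σ i →
    ∃ s', s'.length + 1 = s.length ∧ Exec D (fireAt D σ i) s' μ := by
  intro s
  induction s with
  | nil =>
    intro σ i h hi
    simp only [Exec] at h
    subst h
    have := hμ i
    omega
  | cons c t ih =>
    intro σ i h hi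
    by_cases hc : c = i
    · subst hc
      exact ⟨t, rfl, h.2⟩
    · have h1 := fire_ge (D := D) σ i c (Ne.symm hc)
      have h2 := fire_ge (D := D) σ c i hc
      obtain ⟨s', hl, he⟩ := ih (fireAt D σ c) i h.2 (by omega)
      refine ⟨c :: s', by simp [hl], ?_, ?_⟩
      · have := h.1
        omega
      · rw [← fire_comm hD σ i c hc hi h.1]
        exact he

theorem exec_stable_nil {D : ℕ} {σ μ : Config} (hσ : Stable D σ) {s : List ℕ}
    (h : Exec D σ s μ) : s = [] := by
  cases s with
  | nil => rfl
  | cons i s =>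
    have := hσ i
    have := h.1
    omega

theorem exec_unique {D : ℕ} (hD : 2 ≤ D) (μ ν : Config) (hμ : Stable D μ) (hν : Stable D ν) :
    ∀ (t : List ℕ) (s : List ℕ) (σ : Config), Exec D σ s μ → Exec D σ t ν → μ = ν := by
  intro t
  induction t with
  | nil =>
    intro s σ h1 h2
    simp only [Exec] at h2
    subst h2
    have := exec_stable_nil hν h1
    subst this
    exact h1
  | cons c t ih =>
    intro s σ h1 h2
    obtain ⟨s', _, he⟩ := exec_front hD μ hμ s σ c h1 h2.1
    exact ih s' _ he h2.2

theorem greedy_exists {D : ℕ} (hD : 2 ≤ D) (μ : Config) (hμ : Stable D μ) :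
    ∀ (n : ℕ) (s : List ℕ) (σ : Config), s.length = n → Exec D σ s μ →
    ∃ g, Exec D σ g μ ∧ Gr D σ g := by
  intro n
  induction n with
  | zero =>
    intro s σ hn h
    exact ⟨s, h, by rw [List.length_eq_zero_iff.mp hn]; trivial⟩
  | succ n ih =>
    intro s σ hn h
    by_cases hσ : ∃ i, D ≤ σ i
    · have hf := Nat.find_spec hσ
      obtain ⟨s', hl, he⟩ := exec_front hD μ hμ s σ _ h hf
      obtain ⟨g, hg1, hg2⟩ := ih s' _ (by omega) he
      refine ⟨Nat.find hσ :: g, ⟨hf, hg1⟩, ?_, hg2⟩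
      intro j hj
      have := Nat.find_min hσ hj
      omega
    · push Not at hσ
      have := exec_stable_nil hσ h
      subst this
      simp at hn

theorem greedy_least {D : ℕ} (μ : Config) (hμ : Stable D μ) :
    ∀ (g s : List ℕ) (σ : Config), Exec D σ g μ → Gr D σ g → Exec D σ s μ →
    g = s ∨ List.Lex (· < ·) g s := by
  intro g
  induction g with
  | nil =>
    intro s σ h _ hs
    simp only [Exec] at h
    subst h
    exact Or.inl (exec_stable_nil hμ hs).symm
  | cons i g ih =>
    intro s σ h hg hs
    cases s with
    | nil =>
      simp only [Exec] at hs
      subst hs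
      have := exec_stable_nil hμ h
      simp at this
    | cons c s =>
      rcases lt_trichotomy i c with hic | hic | hic
      · exact Or.inr (List.Lex.rel hic)
      · subst hic
        rcases ih s _ h.2 hg.2 hs.2 with h' | h'
        · exact Or.inl (by rw [h'])
        · exact Or.inr (List.Lex.cons h')
      · have := hg.1 c hic
        have := hs.1
        omega

theorem lex_asymm' : ∀ (a b : List ℕ), List.Lex (· < ·) a b → ¬ List.Lex (· < ·) b a := by
  intro a b h
  induction h with
  | nil => intro h'; cases h'
  | cons _ ih =>
    intro h'
    cases h' with
    | cons h => exact ih h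
    | rel h => exact lt_irrefl _ h
  | rel h =>
    intro h'
    cases h' with
    | cons _ => exact lt_irrefl _ h
    | rel h2 => exact lt_asymm h h2

theorem nodup_of_exec {D : ℕ} (hD : 2 ≤ D) (σ : Config) (hσ : Stable D σ) :
    ∀ (s : List ℕ) (τ : Config), Exec D (addGrain σ) s τ → s.Nodup := by
  intro s
  induction s using List.reverseRecOn with
  | nil => intro τ _; exact List.nodup_nil
  | append_singleton a c ih =>
    intro τ h
    obtain ⟨ν, h1, h2⟩ := (exec_append _ _ _ _).1 h
    have hn := ih ν h1
    have hc := h2.1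
    rw [List.nodup_append]
    refine ⟨hn, by simp, ?_⟩
    intro x hx y hy hxy
    simp at hy
    subst hy
    subst hxy
    have hb := bal_of_exec hD _ _ _ h1 x
    have e1 : a.count x = 1 := List.count_eq_one_of_mem hn hx
    have e2 : a.count (x + 1) ≤ 1 := List.nodup_iff_count_le_one.1 hn _
    have e3 : a.count (x - (D - 1)) ≤ 1 := List.nodup_iff_count_le_one.1 hn _
    have e4 : (D - 1) * a.count (x + 1) ≤ (D - 1) * 1 := Nat.mul_le_mul_left _ e2
    have hs := hσ x
    rw [e1] at hb
    simp only [addGrain] at hb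
    split_ifs at hb <;> omega

theorem fired_lt {D : ℕ} (hD : 2 ≤ D) (σ : Config) (hσ : Stable D σ) (B : ℕ) (hB1 : 1 ≤ B)
    (hB : ∀ j, B ≤ j → σ j = 0) :
    ∀ (s : List ℕ) (τ : Config), Exec D (addGrain σ) s τ → ∀ x ∈ s, x < B := by
  intro s
  induction s using List.reverseRecOn with
  | nil => intro τ _ x hx; simp at hx
  | append_singleton a c ih =>
    intro τ h
    obtain ⟨ν, h1, h2⟩ := (exec_append _ _ _ _).1 h
    have ha := ih ν h1
    have hc := h2.1
    intro x hx
    rcases List.mem_append.1 hx with hx | hx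
    · exact ha x hx
    simp at hx
    subst hx
    by_contra hxB
    have hn := nodup_of_exec hD σ hσ _ _ h1
    have hb := bal_of_exec hD _ _ _ h1 x
    have e2 : a.count (x + 1) = 0 := List.count_eq_zero.2 (fun hm => by have := ha _ hm; omega)
    have e3 : a.count (x - (D - 1)) ≤ 1 := List.nodup_iff_count_le_one.1 hn _
    have hs := hB x (by omega)
    rw [e2] at hb
    simp only [addGrain] at hb
    have := Nat.zero_le (D * a.count x)
    split_ifs at hb <;> omega

theorem stabilizes {D : ℕ} (hD : 2 ≤ D) (σ : Config) (hσ : Stable D σ) (B : ℕ) (hB1 : 1 ≤ B)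
    (hB : ∀ j, B ≤ j → σ j = 0) : ∃ s τ, Exec D (addGrain σ) s τ ∧ Stable D τ := by
  by_contra hcon
  push Not at hcon
  have key : ∀ n, ∃ s τ, Exec D (addGrain σ) s τ ∧ s.length = n := by
    intro n
    induction n with
    | zero => exact ⟨[], _, rfl, rfl⟩
    | succ n ih =>
      obtain ⟨s, τ, h, hl⟩ := ih
      have := hcon s τ h
      simp only [Stable, not_forall, not_lt] at this
      obtain ⟨i, hi⟩ := this
      exact ⟨s ++ [i], fireAt D τ i, (exec_append _ _ _ _).2 ⟨τ, h, hi, rfl⟩, by simp [hl]⟩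
  obtain ⟨s, τ, h, hl⟩ := key (B + 1)
  have h1 := nodup_of_exec hD σ hσ s τ h
  have h2 := fired_lt hD σ hσ B hB1 hB s τ h
  have h3 : s.toFinset ⊆ Finset.range B := by
    intro x hx
    simp at hx ⊢
    exact h2 x hx
  have h4 := Finset.card_le_card h3
  rw [List.toFinset_card_of_nodup h1, Finset.card_range] at h4
  omega

theorem support_exec {D : ℕ} : ∀ (s : List ℕ) (σ τ : Config), Exec D σ s τ →
    (∃ B, ∀ j, B ≤ j → σ j = 0) → ∃ B, ∀ j, B ≤ j → τ j = 0 := by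
  intro s
  induction s with
  | nil =>
    intro σ τ h hB
    simp only [Exec] at h
    subst h
    exact hB
  | cons i s ih =>
    intro σ τ h hB
    refine ih _ _ h.2 ?_
    obtain ⟨B, hB⟩ := hB
    refine ⟨B + i + D + 1, fun j hj => ?_⟩
    have := hB j (by omega)
    simp only [fireAt]
    split_ifs <;> omega

theorem exec_of_reaches {D : ℕ} {σ τ : Config} (h : Reaches D σ τ) : ∃ s, Exec D σ s τ := by
  induction h with
  | refl => exact ⟨[], rfl⟩
  | tail _ h ih =>
    obtain ⟨s, hs⟩ := ih
    obtain ⟨i, hi, he⟩ := h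
    exact ⟨s ++ [i], (exec_append _ _ _ _).2 ⟨_, hs, hi, he⟩⟩

theorem reaches_of_exec {D : ℕ} : ∀ (s : List ℕ) (σ τ : Config), Exec D σ s τ →
    Reaches D σ τ := by
  intro s
  induction s with
  | nil =>
    intro σ τ h
    simp only [Exec] at h
    subst h
    exact Relation.ReflTransGen.refl
  | cons i s ih =>
    intro σ τ h
    exact Relation.ReflTransGen.head ⟨i, h.1, rfl⟩ (ih _ _ h.2)

theorem exec_addGrain {D : ℕ} : ∀ (s : List ℕ) (σ τ : Config), Exec D σ s τ →
    Exec D (addGrain σ) s (addGrain τ) := by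
  intro s
  induction s with
  | nil =>
    intro σ τ h
    simp only [Exec] at h
    subst h
    rfl
  | cons i s ih =>
    intro σ τ h
    have h1 := h.1
    refine ⟨?_, ?_⟩
    · simp only [addGrain]
      split_ifs <;> omega
    · have e : fireAt D (addGrain σ) i = addGrain (fireAt D σ i) := by
        funext j
        simp only [fireAt, addGrain]
        split_ifs <;> first | omega | (subst_vars; omega)
      rw [e]
      exact ih _ _ h.2

theorem grains_succ (k : ℕ) : grains (k + 1) = addGrain (grains k) := by
  funext j
  simp only [grains, addGrain]
  split_ifs <;> rfl

theorem piN_of_exec {D : ℕ} (hD : 2 ≤ D) (k : ℕ) {s : List ℕ} {μ : Config}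
    (h : Exec D (grains k) s μ) (hμ : Stable D μ) : piN D k = μ := by
  have hs : Reaches D (grains k) (piN D k) ∧ Stable D (piN D k) :=
    Classical.epsilon_spec (p := fun μ => Reaches D (grains k) μ ∧ Stable D μ)
      ⟨μ, reaches_of_exec _ _ _ h, hμ⟩
  obtain ⟨t, ht⟩ := exec_of_reaches hs.1
  exact exec_unique hD _ _ hs.2 hμ s t _ ht h

theorem piN_spec {D : ℕ} (hD : 2 ≤ D) (k : ℕ) :
    (∃ s, Exec D (grains k) s (piN D k)) ∧ Stable D (piN D k) ∧
      ∃ B, ∀ j, B ≤ j → piN D k j = 0 := by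
  have key : ∃ s μ, Exec D (grains k) s μ ∧ Stable D μ := by
    induction k with
    | zero =>
      refine ⟨[], grains 0, rfl, ?_⟩
      intro i
      simp only [grains]
      split_ifs <;> omega
    | succ k ih =>
      obtain ⟨s, μ, h, hμ⟩ := ih
      obtain ⟨B, hB⟩ := support_exec _ _ _ h ⟨1, fun j hj => by
        simp only [grains]; split_ifs <;> omega⟩
      obtain ⟨t, ν, ht, hν⟩ := stabilizes hD μ hμ (B + 1) (by omega)
        (fun j hj => hB j (by omega))
      refine ⟨s ++ t, ν, (exec_append _ _ _ _).2 ⟨addGrain μ, ?_, ht⟩, hν⟩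
      rw [grains_succ]
      exact exec_addGrain _ _ _ h
  obtain ⟨s, μ, h, hμ⟩ := key
  have e := piN_of_exec hD k h hμ
  rw [e]
  exact ⟨⟨s, h⟩, hμ, support_exec _ _ _ h ⟨1, fun j hj => by
        simp only [grains]; split_ifs <;> omega⟩⟩

theorem avalanche_spec {D : ℕ} (hD : 2 ≤ D) (k : ℕ) (hk : 1 ≤ k) :
    Exec D (addGrain (piN D (k - 1))) (avalanche D k) (piN D k) ∧
    Gr D (addGrain (piN D (k - 1))) (avalanche D k) := by
  obtain ⟨k, rfl⟩ : ∃ m, k = m + 1 := ⟨k - 1, by omega⟩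
  simp only [Nat.add_sub_cancel]
  obtain ⟨⟨s, hs⟩, hst, B, hB⟩ := piN_spec hD k
  have hst' := (piN_spec hD (k + 1)).2.1
  obtain ⟨t, ν, ht, hν⟩ := stabilizes hD _ hst (B + 1) (by omega)
        (fun j hj => hB j (by omega))
  have e : piN D (k + 1) = ν := by
    refine piN_of_exec hD (k + 1) (s := s ++ t) ?_ hν
    refine (exec_append _ _ _ _).2 ⟨_, ?_, ht⟩
    rw [grains_succ]
    exact exec_addGrain _ _ _ hs
  rw [← e] at ht
  obtain ⟨g, hg1, hg2⟩ := greedy_exists hD _ hst' _ t _ rfl ht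
  have hg3 : ∀ s', Exec D (addGrain (piN D k)) s' (piN D (k + 1)) →
      g = s' ∨ List.Lex (· < ·) g s' := fun s' h' => greedy_least _ hst' g s' _ hg1 hg2 h'
  have hav : Exec D (addGrain (piN D k)) (avalanche D (k + 1)) (piN D (k + 1)) ∧
      ∀ s', Exec D (addGrain (piN D k)) s' (piN D (k + 1)) →
      avalanche D (k + 1) = s' ∨ List.Lex (· < ·) (avalanche D (k + 1)) s' :=
    Classical.epsilon_spec (p := fun s => Exec D (addGrain (piN D k)) s (piN D (k + 1)) ∧
      ∀ s', Exec D (addGrain (piN D k)) s' (piN D (k + 1)) → s = s' ∨ List.Lex (· < ·) s s')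
      ⟨g, hg1, hg3⟩
  have e : avalanche D (k + 1) = g := by
    rcases hav.2 g hg1 with h | h
    · exact h
    rcases hg3 _ hav.1 with h' | h'
    · exact h'.symm
    · exact absurd h' (lex_asymm' _ _ h)
  rw [e]
  exact ⟨hg1, hg2⟩

theorem isPeak_iff (s : List ℕ) (p : ℕ) :
    IsPeak s p ↔ ∃ a b, s = a ++ p :: b ∧ ∀ x ∈ a, x < p := by
  constructor
  · rintro ⟨t, ht, hlt⟩
    refine ⟨s.take t, s.drop (t + 1), ?_, ?_⟩
    · rw [← ht]
      simp
    · intro x hx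
      obtain ⟨n, hn, rfl⟩ := List.mem_iff_getElem.1 hx
      simp at hn
      have := hlt ⟨n, by omega⟩ (by simpa [Fin.lt_def] using hn)
      simpa using this
  · rintro ⟨a, b, rfl, h⟩
    refine ⟨⟨a.length, by simp⟩, by simp, ?_⟩
    rintro ⟨n, hn⟩ hlt
    simp [Fin.lt_def] at hlt
    simp only [List.get_eq_getElem, List.getElem_append_left hlt]
    exact h _ (List.getElem_mem _)

/-- Everything used about an avalanche. -/
structure Av (D : ℕ) (σ : Config) (s : List ℕ) (μ : Config) : Prop where
  hD : 2 ≤ D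
  st : Stable D σ
  st' : Stable D μ
  nd : s.Nodup
  bal : Bal D (addGrain σ) s μ
  split : ∀ a p b, s = a ++ p :: b →
    ∃ ν, Bal D (addGrain σ) a ν ∧ D ≤ ν p ∧ ∀ j < p, ν j < D

theorem av_avalanche {D : ℕ} (hD : 2 ≤ D) (k : ℕ) (hk : 1 ≤ k) :
    Av D (piN D (k - 1)) (avalanche D k) (piN D k) := by
  obtain ⟨h1, h2⟩ := avalanche_spec hD k hk
  have hst := (piN_spec hD (k - 1)).2.1
  refine ⟨hD, hst, (piN_spec hD k).2.1, nodup_of_exec hD _ hst _ _ h1,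
    bal_of_exec hD _ _ _ h1, ?_⟩
  intro a p b e
  rw [e] at h1 h2
  obtain ⟨ν, h3, h4⟩ := gr_split a b p _ _ h1 h2
  exact ⟨ν, bal_of_exec hD _ _ _ h3, h4⟩

theorem exists_first {P : ℕ → Prop} : ∀ (s : List ℕ), (∃ x ∈ s, P x) →
    ∃ a p b, s = a ++ p :: b ∧ P p ∧ ∀ x ∈ a, ¬ P x := by
  intro s
  induction s with
  | nil => rintro ⟨x, hx, _⟩; simp at hx
  | cons c s ih =>
    intro h
    by_cases hc : P c
    · exact ⟨[], c, s, rfl, hc, by simp⟩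
    · obtain ⟨x, hx, hp⟩ := h
      rcases List.mem_cons.1 hx with rfl | hx
      · exact absurd hp hc
      · obtain ⟨a, p, b, e, h1, h2⟩ := ih ⟨x, hx, hp⟩
        refine ⟨c :: a, p, b, by simp [e], h1, ?_⟩
        intro y hy
        rcases List.mem_cons.1 hy with rfl | hy
        · exact hc
        · exact h2 y hy

theorem peak_closed {D : ℕ} {σ μ : Config} {s : List ℕ} (A : Av D σ s μ) {a b : List ℕ} {p : ℕ}
    (e : s = a ++ p :: b) (hp : ∀ x ∈ a, x < p) : ∀ c ∈ b, ∀ x ∈ a, x < c := by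
  by_contra hcon
  push Not at hcon
  obtain ⟨b1, c, b2, eb, ⟨x, hx, hcx⟩, hb1⟩ := exists_first (P := fun c => ∃ x ∈ a, c ≤ x) b hcon
  have hD := A.hD
  have nd := A.nd
  obtain ⟨ν, hν, _, hν2⟩ := A.split a p b e
  obtain ⟨ν', hν', hν3, _⟩ := A.split (a ++ p :: b1) c b2 (by rw [e, eb]; simp)
  have hpx := hp x hx
  have hca : c ∉ a := by
    rw [e, eb, List.nodup_append] at nd
    intro h
    exact nd.2.2 c h c (by simp) rfl
  have hne : c ≠ x := fun h => hca (h ▸ hx)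
  have hcnt : ∀ y, y ≤ x → (a ++ p :: b1).count y = a.count y := by
    intro y hy
    suffices h0 : (p :: b1).count y = 0 by
      rw [List.count_append, h0, Nat.add_zero]
    rw [List.count_eq_zero]
    intro h
    rcases List.mem_cons.1 h with h | h
    · omega
    · exact hb1 y h ⟨x, hx, hy⟩
  have b1 := hν c
  have b2 := hν' c
  rw [hcnt c hcx, hcnt (c + 1) (by omega), hcnt (c - (D - 1)) (by omega)] at b2
  have := hν2 c (by omega)
  omega

theorem peak_val {D : ℕ} {σ μ : Config} {s : List ℕ} (A : Av D σ s μ) {a b : List ℕ} {p : ℕ}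
    (e : s = a ++ p :: b) (hp : ∀ x ∈ a, x < p) (hp1 : 1 ≤ p) :
    σ p = D - 1 ∧ D - 1 ≤ p ∧ p - (D - 1) ∈ a := by
  obtain ⟨ν, hν, h1, _⟩ := A.split a p b e
  have hD := A.hD
  have nd := A.nd
  rw [e, List.nodup_append] at nd
  have hb := hν p
  have e1 : a.count p = 0 := List.count_eq_zero.2 (fun h => lt_irrefl _ (hp p h))
  have e2 : a.count (p + 1) = 0 := List.count_eq_zero.2 (fun h => by have := hp _ h; omega)
  have e3 : a.count (p - (D - 1)) ≤ 1 := List.nodup_iff_count_le_one.1 nd.1 _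
  have hs := A.st p
  rw [e1, e2] at hb
  simp only [addGrain] at hb
  rw [if_neg (by omega)] at hb
  split_ifs at hb with hc
  · refine ⟨by omega, hc, List.count_pos_iff.1 (by omega)⟩
  · omega

theorem peak_of_val {D : ℕ} {σ μ : Config} {s : List ℕ} (A : Av D σ s μ) {i : ℕ}
    (hi : i ∈ s) (hiD : D - 1 ≤ i) (him : i - (D - 1) ∈ s) (hv : σ i = D - 1) :
    IsPeak s i := by
  rw [isPeak_iff]
  have hD := A.hD
  obtain ⟨a, p, b, e, hpi, ha⟩ := exists_first (P := fun c => i ≤ c) s ⟨i, hi, le_refl _⟩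
  simp only [not_le] at ha
  rcases eq_or_lt_of_le hpi with rfl | hlt
  · exact ⟨a, b, e, ha⟩
  exfalso
  have hp : ∀ x ∈ a, x < p := fun x hx => lt_trans (ha x hx) hlt
  obtain ⟨_, _, hpa⟩ := peak_val A e hp (by omega)
  have hia : i - (D - 1) ∈ a := by
    rw [e] at him
    rcases List.mem_append.1 him with h | h
    · exact h
    rcases List.mem_cons.1 h with h | h
    · omega
    · have := peak_closed A e hp _ h _ hpa
      omega
  obtain ⟨ν, hν, _, h2⟩ := A.split a p b e
  have hb := hν i
  have e1 : a.count i = 0 := List.count_eq_zero.2 (fun h => lt_irrefl _ (ha i h))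
  have e3 : 0 < a.count (i - (D - 1)) := List.count_pos_iff.2 hia
  have := h2 i hlt
  rw [e1, if_pos hiD] at hb
  simp only [addGrain] at hb
  split_ifs at hb <;> omega

theorem peak_mem {s : List ℕ} {p : ℕ} (h : IsPeak s p) : p ∈ s := by
  obtain ⟨t, rfl, _⟩ := h
  exact List.get_mem _ _

theorem max_peak {s : List ℕ} {m : ℕ} (hm : m ∈ s) : ∃ q, IsPeak s q ∧ m ≤ q ∧ ∀ x ∈ s, x ≤ q := by
  obtain ⟨q, hq, hmax⟩ := Finset.exists_max_image s.toFinset id ⟨m, by simpa using hm⟩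
  simp only [List.mem_toFinset, id] at hq hmax
  refine ⟨q, ?_, hmax m hm, hmax⟩
  rw [isPeak_iff]
  obtain ⟨a, p, b, e, h, h'⟩ := exists_first (P := fun c => c = q) s ⟨q, hq, rfl⟩
  subst h
  refine ⟨a, b, e, fun x hx => lt_of_le_of_ne (hmax x (by rw [e]; simp [hx])) (h' x hx)⟩

theorem dense_Lgdc {D N k : ℕ} (hk1 : 1 ≤ k) (hkN : k ≤ N) {i j : ℕ}
    (hi : i ∈ avalanche D k) (hj : Lgdc D N ≤ j) (hji : j ≤ i) : j ∈ avalanche D k := by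
  have hne : {l | DenseFrom (avalanche D k) l}.Nonempty := by
    obtain ⟨q, _, _, hq⟩ := max_peak hi
    refine ⟨q + 1, q, fun i h1 h2 => by omega, fun i h1 h2 => ?_⟩
    have := hq i h2
    omega
  obtain ⟨m, hm1, hm2⟩ := Nat.sInf_mem hne
  have hle : Lp D k ≤ Lgdc D N := Finset.le_sup (f := Lp D) (by simp; omega)
  refine hm1 j (le_trans hle hj) ?_
  by_contra h
  exact hm2 i (by omega) hi

/-- Peaks `≥ L + 2(D−1)` of two consecutive long avalanches `φ^k = s^{k1}` and
`φ^{k+1} = s^{k2}` coincide, except that the largest peak `M` of the first may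
disappear: `P^k \ {M} = P^{k+1} ∩ [L+2(D−1), M)`. -/
theorem successive_long_avalanches_peaks (D N : ℕ) (hD : 2 ≤ D) (k1 k2 : ℕ)
    (h1 : k1 ∈ longList D N) (h2 : k2 ∈ longList D N) (h12 : k1 < k2)
    (hconsec : ∀ k, k1 < k → k < k2 → k ∉ longList D N)
    (M : ℕ)
    (hM : IsPeak (avalanche D k1) M ∧ Lgdc D N + 2 * (D - 1) ≤ M)
    (hMmax : ∀ q, IsPeak (avalanche D k1) q →
      Lgdc D N + 2 * (D - 1) ≤ q → q ≤ M) :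
    {q | IsPeak (avalanche D k1) q ∧ Lgdc D N + 2 * (D - 1) ≤ q} \ {M} =
      {q | IsPeak (avalanche D k2) q ∧ Lgdc D N + 2 * (D - 1) ≤ q} ∩
        Set.Ico (Lgdc D N + 2 * (D - 1)) M := by
  have hmem : ∀ k, k ∈ longList D N ↔ (k ≤ N ∧ 1 ≤ k ∧ Lgdc D N + D - 1 ∈ avalanche D k) := by
    intro k
    simp [longList, Nat.lt_succ_iff]
  rw [hmem] at h1 h2
  obtain ⟨h1N, h11, h1L⟩ := h1
  obtain ⟨h2N, h21, h2L⟩ := h2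
  have dense : ∀ k, 1 ≤ k → k ≤ N → ∀ i ∈ avalanche D k, ∀ j, Lgdc D N ≤ j → j ≤ i →
      j ∈ avalanche D k := fun k hk hkN i hi j hj hji => dense_Lgdc hk hkN hi hj hji
  generalize Lgdc D N = L at *
  have A1 := av_avalanche hD k1 h11
  have A2 := av_avalanche hD k2 h21
  -- the greatest fired column of the first avalanche is `M`
  have hM1 : ∀ x ∈ avalanche D k1, x ≤ M := by
    obtain ⟨q, hq, hMq, hmax⟩ := max_peak (peak_mem hM.1)
    intro x hx
    exact le_trans (hmax x hx) (hMmax q hq (by omega))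
  have hMm := peak_mem hM.1
  -- the first avalanche changes nothing on `[L + D - 1, M)`
  have same : ∀ i, L + D - 1 ≤ i → i < M → piN D k1 i = piN D (k1 - 1) i := by
    intro i hi hiM
    have hb := A1.bal i
    have c1 : (avalanche D k1).count i = 1 :=
      List.count_eq_one_of_mem A1.nd (dense k1 h11 h1N M hMm i (by omega) (by omega))
    have c2 : (avalanche D k1).count (i + 1) = 1 :=
      List.count_eq_one_of_mem A1.nd (dense k1 h11 h1N M hMm (i + 1) (by omega) (by omega))
    have c3 : (avalanche D k1).count (i - (D - 1)) = 1 :=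
      List.count_eq_one_of_mem A1.nd
        (dense k1 h11 h1N M hMm (i - (D - 1)) (by omega) (by omega))
    rw [c1, c2, c3, if_pos (by omega)] at hb
    simp only [addGrain] at hb
    rw [if_neg (by omega)] at hb
    omega
  -- the short avalanches in between
  have inter : ∀ k, k1 ≤ k → k < k2 → ∀ i, L + D - 1 ≤ i →
      piN D k1 i ≤ piN D k i ∧ (L + 2 * (D - 1) ≤ i → piN D k i = piN D k1 i) := by
    intro k hk
    induction k, hk using Nat.le_induction with
    | base => intro _ i _; exact ⟨le_refl _, fun _ => rfl⟩
    | succ k hk ih =>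
      intro hk2 i hi
      obtain ⟨ih1, ih2⟩ := ih (by omega) i hi
      have A := av_avalanche hD (k + 1) (by omega)
      have hshort : ∀ x, L + D - 1 ≤ x → (avalanche D (k + 1)).count x = 0 := by
        intro x hx
        rw [List.count_eq_zero]
        intro hxm
        refine hconsec (k + 1) (by omega) hk2 ((hmem _).2 ⟨by omega, by omega, ?_⟩)
        exact dense (k + 1) (by omega) (by omega) x hxm _ (by omega) hx
      have hb := A.bal i
      rw [hshort i hi, hshort (i + 1) (by omega), if_pos (by omega)] at hb
      simp only [addGrain, Nat.add_sub_cancel] at hb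
      rw [if_neg (by omega)] at hb
      refine ⟨by omega, fun hi2 => ?_⟩
      rw [hshort (i - (D - 1)) (by omega)] at hb
      have := ih2 hi2
      omega
  have val2 : ∀ i, L + D - 1 ≤ i → i < M → piN D (k1 - 1) i = D - 1 →
      piN D (k2 - 1) i = D - 1 := by
    intro i hi hiM hv
    have h3 := (inter (k2 - 1) (by omega) (by omega) i hi).1
    have h4 := same i hi hiM
    have h5 := A2.st i
    omega
  -- the second avalanche reaches every peak of the first one below `M`
  have reach : ∀ q, IsPeak (avalanche D k1) q → L + D - 1 ≤ q → q < M → q ∈ avalanche D k2 := by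
    intro q
    induction q using Nat.strong_induction_on with
    | _ q ih =>
      intro hq hqL hqM
      rcases eq_or_lt_of_le hqL with e | hlt
      · rw [← e]; exact h2L
      by_contra hcon
      obtain ⟨a, b, e, ha⟩ := (isPeak_iff _ _).1 hq
      obtain ⟨hv, _, hqa⟩ := peak_val A1 e ha (by omega)
      have hv2 := val2 q hqL hqM hv
      by_cases hm : q - (D - 1) ∈ avalanche D k2
      · have hb := A2.bal q
        have c1 : (avalanche D k2).count q = 0 := List.count_eq_zero.2 hcon
        have c3 : 0 < (avalanche D k2).count (q - (D - 1)) := List.count_pos_iff.2 hm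
        have hs := A2.st' q
        rw [c1, if_pos (by omega)] at hb
        simp only [addGrain] at hb
        rw [if_neg (by omega)] at hb
        omega
      · obtain ⟨p, hp, hpq, hpmax⟩ := max_peak hqa
        have hpa := peak_mem hp
        have hp1 : IsPeak (avalanche D k1) p := by
          obtain ⟨a1, a2, ea, h⟩ := (isPeak_iff _ _).1 hp
          exact (isPeak_iff _ _).2 ⟨a1, a2 ++ q :: b, by rw [e, ea]; simp, h⟩
        have hpq' := ha p hpa
        by_cases hc : L + D - 1 ≤ q - (D - 1)
        · have := ih p hpq' hp1 (by omega) (by omega)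
          exact hm (dense k2 h21 h2N p this _ (by omega) hpq)
        · exact hm (dense k2 h21 h2N _ h2L _ (by omega) (by omega))
  ext q
  simp only [Set.mem_diff, Set.mem_inter_iff, Set.mem_setOf_eq, Set.mem_singleton_iff,
    Set.mem_Ico]
  constructor
  · rintro ⟨⟨hq, hqL⟩, hqM⟩
    have hlt : q < M := lt_of_le_of_ne (hMmax q hq hqL) hqM
    refine ⟨⟨?_, hqL⟩, hqL, hlt⟩
    have hm := reach q hq (by omega) hlt
    obtain ⟨a, b, e, ha⟩ := (isPeak_iff _ _).1 hq
    obtain ⟨hv, _, _⟩ := peak_val A1 e ha (by omega)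
    exact peak_of_val A2 hm (by omega) (dense k2 h21 h2N q hm _ (by omega) (by omega))
      (val2 q (by omega) hlt hv)
  · rintro ⟨⟨hq, hqL⟩, _, hlt⟩
    refine ⟨⟨?_, hqL⟩, by omega⟩
    obtain ⟨a, b, e, ha⟩ := (isPeak_iff _ _).1 hq
    obtain ⟨hv, _, _⟩ := peak_val A2 e ha (by omega)
    have h3 := (inter (k2 - 1) (by omega) (by omega) q (by omega)).2 hqL
    have h4 := same q (by omega) hlt
    exact peak_of_val A1 (dense k1 h11 h1N M hMm q (by omega) (by omega)) (by omega)
      (dense k1 h11 h1N M hMm _ (by omega) (by omega)) (by omega)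
end
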